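/- arXiv:2101.08337 — 15 statements merged into one kernel-verified Lean document; each statement's English description precedes it below -/
import Mathlib

section
/- Let (R, m) be a local domain. Then R is a Henselian local ring if and only if for every integral ring extension R ⊆ A such that A is an integral domain, the ring A is local (has a unique maximal ideal). -/
open Polynomial IsLocalRing

/-- A Henselian local ring `R` is a retract of every étale `R`-algebra having a prime above the
maximal ideal of `R` with trivial residue field extension. -/
theorem HenselianLocalRing.exists_algHom_of_etale {R S : Type u} [CommRing R]
    [HenselianLocalRing R] [CommRing S] [Algebra R S] [Algebra.Etale R S] (Q : Ideal S) [Q.IsPrime]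
    [Q.LiesOver (maximalIdeal R)]
    (hQ : Function.Bijective (Ideal.ResidueField.mapₐ (maximalIdeal R) Q (Algebra.ofId R S)
      (Q.over_def (maximalIdeal R)))) : Nonempty (S →ₐ[R] R) := by
  obtain ⟨f, hfQ, ⟨⟨P⟩⟩⟩ := Algebra.IsEtaleAt.exists_isStandardEtale (R := R) Q
  let ψ : S →ₐ[R] (maximalIdeal R).ResidueField :=
    ((AlgEquiv.ofBijective _ hQ).symm.toAlgHom).comp (IsScalarTower.toAlgHom R S Q.ResidueField)
  have hψ : IsUnit (ψ f) := by
    simpa [ψ] using hfQ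
  let ψ' : Localization.Away f →ₐ[R] (maximalIdeal R).ResidueField :=
    IsLocalization.Away.liftAlgHom (f := ψ) f hψ
  have hx := P.hasMap.map ψ'
  have hsurj : Function.Surjective (algebraMap R (maximalIdeal R).ResidueField) :=
    Ideal.algebraMap_residueField_surjective _
  have hlift := (HenselianLocalRing.TFAE R).out 0 2
  obtain ⟨a, ha, hax⟩ := hlift.mp ‹_› _ hsurj P.f P.monic_f (ψ' P.x) hx.1
    hx.isUnit_derivative_f.ne_zero
  have : IsLocalHom (algebraMap R (maximalIdeal R).ResidueField) := hsurj.isLocalHom _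
  have hmap : P.HasMap a := by
    refine ⟨ha, .of_map (algebraMap R (maximalIdeal R).ResidueField) _ ?_⟩
    rw [← aeval_algebraMap_apply, hax]
    exact hx.2
  exact ⟨((P.lift a hmap).comp P.equivRing.toAlgHom).comp (IsScalarTower.toAlgHom R S _)⟩

/-- Coprime monic factorizations over the residue field of a Henselian local ring lift. -/
theorem HenselianLocalRing.exists_monic_mul_eq {R : Type*} [CommRing R] [HenselianLocalRing R]
    {p : R[X]} (hp : p.Monic) {f g : (maximalIdeal R).ResidueField[X]} (hf : f.Monic)
    (hg : g.Monic) (H : p.map (algebraMap R _) = f * g) (hfg : IsCoprime f g) :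
    ∃ f' g' : R[X], f'.Monic ∧ g'.Monic ∧ p = f' * g' ∧ f'.natDegree = f.natDegree ∧
      g'.natDegree = g.natDegree := by
  obtain ⟨R', _, _, _, Q, _, _, f', g', hQ, hf', hg', hp', -, hff', hgg'⟩ :=
    Algebra.exists_etale_bijective_residueFieldMap_and_map_eq_mul_and_isCoprime
      (maximalIdeal R) p f g hp hf hg H hfg
  obtain ⟨σ⟩ := HenselianLocalRing.exists_algHom_of_etale Q hQ
  refine ⟨f'.map σ.toRingHom, g'.map σ.toRingHom, hf'.map _, hg'.map _, ?_, ?_, ?_⟩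
  · rw [← Polynomial.map_mul, ← hp', Polynomial.map_map]
    simp
  · have : Nontrivial R' := σ.toRingHom.domain_nontrivial
    simpa [hf'.natDegree_map] using (congrArg natDegree hff').symm
  · have : Nontrivial R' := σ.toRingHom.domain_nontrivial
    simpa [hg'.natDegree_map] using (congrArg natDegree hgg').symm

/-- If `p` takes a unit value at `r`, then `r` differs from every root of `p` by a unit. -/
theorem Polynomial.isUnit_algebraMap_sub_of_isUnit_eval {R A : Type*} [CommRing R] [CommRing A]
    [Algebra R A] {p : R[X]} {a : A} (ha : aeval a p = 0) {r : R} (hr : IsUnit (p.eval r)) :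
    IsUnit (algebraMap R A r - a) := by
  have h := sub_dvd_eval_sub (algebraMap R A r) a (p.map (algebraMap R A))
  rw [eval_map_algebraMap, eval_map_algebraMap, ha, sub_zero, aeval_algebraMap_apply] at h
  exact isUnit_of_dvd_unit h (hr.map (algebraMap R A))

/-- An integral extension of a Henselian local ring that is a domain is local. -/
theorem HenselianLocalRing.isLocalRing_of_isIntegral {R A : Type*} [CommRing R]
    [HenselianLocalRing R] [CommRing A] [IsDomain A] [Algebra R A] [Algebra.IsIntegral R A] :
    IsLocalRing A := by
  refine .of_isUnit_or_isUnit_one_sub_self fun a ↦ ?_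
  have ha : IsIntegral R a := Algebra.IsIntegral.isIntegral a
  set p := minpoly R a
  have hp : p.Monic := minpoly.monic ha
  have hpa : aeval a p = 0 := minpoly.aeval R a
  let φ := algebraMap R (maximalIdeal R).ResidueField
  have hφ : Function.Surjective φ := Ideal.algebraMap_residueField_surjective _
  have : IsLocalHom φ := hφ.isLocalHom _
  have isUnit_eval (r : R) (h : (p.map φ).eval (φ r) ≠ 0) : IsUnit (p.eval r) := by
    rw [eval_map_apply] at h
    exact .of_map φ _ h.isUnit
  obtain ⟨h, hph, hXh⟩ := (p.map φ).exists_eq_pow_rootMultiplicity_mul_and_not_dvd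
    (hp.map φ).ne_zero 0
  set k := (p.map φ).rootMultiplicity 0
  rw [C_0, sub_zero] at hph hXh
  have hh : h.Monic := (monic_X_pow k).of_mul_monic_left (hph ▸ hp.map φ)
  have hcop : IsCoprime (X ^ k) h :=
    ((irreducible_X.coprime_iff_not_dvd).mpr hXh).pow_left
  obtain ⟨f', g', hf', hg', hfg, hdf, hdg⟩ :=
    HenselianLocalRing.exists_monic_mul_eq hp (monic_X_pow k) hh hph hcop
  have hdeg := hf'.natDegree_mul hg'
  rw [← hfg, hdf, hdg, natDegree_X_pow] at hdeg
  have hmul : aeval a f' * aeval a g' = 0 := by rw [← map_mul, ← hfg, hpa]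
  rcases mul_eq_zero.mp hmul with h0 | h0
  · right
    have hle := natDegree_le_natDegree (minpoly.min R a hf' h0)
    have hh1 : h = 1 := hh.natDegree_eq_zero.mp (by simp [p] at *; omega)
    simpa using isUnit_algebraMap_sub_of_isUnit_eval hpa (isUnit_eval 1 (by simp [hph, hh1]))
  · left
    have hle := natDegree_le_natDegree (minpoly.min R a hg' h0)
    have hk : k = 0 := by simp [p] at *; omega
    simpa using isUnit_algebraMap_sub_of_isUnit_eval hpa (isUnit_eval 0 (by
      rw [hph, hk, pow_zero, one_mul, map_zero, ← coeff_zero_eq_eval_zero]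
      rwa [X_dvd_iff] at hXh))

/-- A root `b` of a polynomial `f` over a local ring `R` lies in `R` if it generates a local
integral extension of `R` and is congruent, modulo the maximal ideal of that extension, to some
`a : R` reducing to a simple root of `f` in the residue field of `R`. -/
theorem IsLocalRing.mem_range_algebraMap_of_adjoin_eq_top {R B : Type*} [CommRing R]
    [IsLocalRing R] [CommRing B] [IsLocalRing B] [Algebra R B] [Algebra.IsIntegral R B] {b : B}
    (hb : Algebra.adjoin R {b} = ⊤) {f : R[X]} (hfb : aeval b f = 0) {a : R}
    (hfa : f.eval a ∈ maximalIdeal R) (hfa' : IsUnit (f.derivative.eval a))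
    (hab : ¬ IsUnit (b - algebraMap R B a)) : b ∈ Set.range (algebraMap R B) := by
  have hmem : b - algebraMap R B a ∈ (maximalIdeal R).map (algebraMap R B) := by
    obtain ⟨c, hc⟩ := exists_mul_sq_add_linear_part_eq_eval_add (f.map (algebraMap R B))
      (algebraMap R B a) (b - algebraMap R B a)
    rw [add_sub_cancel, eval_map_algebraMap f b, hfb, derivative_map, eval_map_apply,
      eval_map_apply] at hc
    have hu : IsUnit (c * (b - algebraMap R B a) + algebraMap R B (f.derivative.eval a)) := by
      by_contra hu
      refine (mem_maximalIdeal _).mp ?_ (hfa'.map (algebraMap R B))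
      rw [← Ideal.add_mem_iff_right _ (Ideal.mul_mem_left _ c ((mem_maximalIdeal _).mpr hab))]
      exact (mem_maximalIdeal _).mpr hu
    rw [← Ideal.unit_mul_mem_iff_mem _ hu]
    convert! neg_mem (Ideal.mem_map_of_mem (algebraMap R B) hfa) using 1
    linear_combination hc
  have hle : (⊤ : Submodule R B) ≤
      Subalgebra.toSubmodule ⊥ ⊔ maximalIdeal R • (⊤ : Submodule R B) := by
    rintro x -
    obtain ⟨q, rfl⟩ : x ∈ (aeval (R := R) b).range := by
      rw [← Algebra.adjoin_singleton_eq_range_aeval, hb]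
      trivial
    refine Submodule.mem_sup.mpr ⟨algebraMap R B (q.eval a), Subalgebra.algebraMap_mem _ _,
      aeval b q - algebraMap R B (q.eval a), ?_, add_sub_cancel _ _⟩
    rw [Ideal.smul_top_eq_map, Submodule.restrictScalars_mem]
    refine Ideal.mem_of_dvd _ ?_ hmem
    simpa [aeval_algebraMap_apply_eq_algebraMap_eval] using
      sub_dvd_eval_sub b (algebraMap R B a) (q.map (algebraMap R B))
  have hfin : (⊤ : Submodule R B).FG := by
    rw [← Algebra.top_toSubmodule, ← hb]
    exact (Algebra.IsIntegral.isIntegral b).fg_adjoin_singleton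
  exact Algebra.mem_bot.mp
    (Submodule.le_of_le_smul_of_le_jacobson_bot hfin (maximalIdeal_le_jacobson ⊥) hle trivial)

/-- If `f` takes a non-unit value at `a`, then over an algebraically closed field some root of `f`
differs from `a` by a non-unit of the integral closure. -/
theorem Polynomial.Monic.exists_aeval_eq_zero_not_isUnit_sub {R : Type*} (K : Type*) [CommRing R]
    [Field K] [IsAlgClosed K] [Algebra R K] [FaithfulSMul R K] {f : R[X]} (hf : f.Monic) {a : R}
    (ha : ¬ IsUnit (f.eval a)) :
    ∃ r : integralClosure R K, aeval r f = 0 ∧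
      ¬ IsUnit (r - algebraMap R (integralClosure R K) a) := by
  by_contra! H
  apply ha
  have hsplit := IsAlgClosed.splits (f.map (algebraMap R K))
  have hroots : ∀ r ∈ (f.map (algebraMap R K)).roots, r ∈ integralClosure R K := fun r hr ↦
    ⟨f, hf, by simpa [← aeval_def, eval_map_algebraMap] using (mem_roots'.mp hr).2⟩
  obtain ⟨t, ht⟩ : ∃ t : Multiset (integralClosure R K),
      t.map Subtype.val = (f.map (algebraMap R K)).roots :=
    ⟨(f.map (algebraMap R K)).roots.attach.map fun r ↦ ⟨r.1, hroots _ r.2⟩, by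
      simp [Multiset.map_map]⟩
  have hprod : algebraMap R (integralClosure R K) (f.eval a) =
      (t.map fun r ↦ algebraMap R (integralClosure R K) a - r).prod := by
    apply Subtype.val_injective
    have := hsplit.eval_eq_prod_roots_of_monic (hf.map _) (algebraMap R K a)
    rw [eval_map_apply, ← ht, Multiset.map_map] at this
    refine this.trans ?_
    simp
  have : FaithfulSMul R (integralClosure R K) := (faithfulSMul_iff_algebraMap_injective _ _).mpr
    (.of_comp (f := Subtype.val) (FaithfulSMul.algebraMap_injective R K))
  refine .of_map (algebraMap R (integralClosure R K)) _ ?_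
  rw [hprod]
  refine (IsUnit.submonoid _).multiset_prod_mem _ fun x hx ↦ ?_
  obtain ⟨r, hr, rfl⟩ := Multiset.mem_map.mp hx
  rw [IsUnit.mem_submonoid_iff, ← IsUnit.neg_iff, neg_sub]
  refine H r (Subtype.val_injective ?_)
  have hr' : (r : K) ∈ (f.map (algebraMap R K)).roots := ht ▸ Multiset.mem_map_of_mem _ hr
  simpa [eval_map_algebraMap] using (mem_roots'.mp hr').2

/-- A local domain all of whose integral extension domains are local is Henselian. -/
theorem HenselianLocalRing.of_forall_isLocalRing {R : Type u} [CommRing R] [IsDomain R]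
    [IsLocalRing R]
    (H : ∀ (A : Type u) [CommRing A] [IsDomain A] [Algebra R A],
      Function.Injective (algebraMap R A) → Algebra.IsIntegral R A → IsLocalRing A) :
    HenselianLocalRing R where
  is_henselian f hf a hfa hfa' := by
    obtain ⟨K, _, _, _, _⟩ : ∃ (K : Type u) (_ : Field K) (_ : IsAlgClosed K) (_ : Algebra R K),
        FaithfulSMul R K :=
      ⟨AlgebraicClosure (FractionRing R), inferInstance, inferInstance, inferInstance,
        .trans R (FractionRing R) _⟩
    obtain ⟨r, hr, hra⟩ := hf.exists_aeval_eq_zero_not_isUnit_sub K ((mem_maximalIdeal _).mp hfa)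
    let B := Algebra.adjoin R {r}
    have hinj : Function.Injective (algebraMap R B) :=
      .of_comp (f := fun x : B ↦ (x.1 : K)) (FaithfulSMul.algebraMap_injective R K)
    have hint : Algebra.IsIntegral R B := .of_injective B.val Subtype.val_injective
    have : IsLocalRing B := H B hinj hint
    let b : B := ⟨r, Algebra.self_mem_adjoin_singleton R r⟩
    have hb : aeval b f = 0 := Subtype.val_injective (by simpa [b] using hr)
    have hba : ¬ IsUnit (b - algebraMap R B a) := fun h ↦ hra (h.map B.val)
    have hgen : Algebra.adjoin R {b} = ⊤ := by
      rw [← Algebra.adjoin_adjoin_coe_preimage (R := R) (s := {r})]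
      congr 1
      ext x
      simp only [b, Set.mem_singleton_iff, Set.mem_preimage, Subtype.ext_iff]
    obtain ⟨c, hc⟩ := mem_range_algebraMap_of_adjoin_eq_top hgen hb hfa hfa' hba
    refine ⟨c, hinj ?_, ?_⟩
    · rw [map_zero, ← aeval_algebraMap_apply_eq_algebraMap_eval, hc, hb]
    · rw [mem_maximalIdeal]
      intro h
      apply hba
      rw [← hc, ← map_sub]
      exact h.map _

/-- Let `(R, m)` be a local domain. Then `R` is a Henselian local ring if and
only if for every integral ring extension `R ⊆ A` (i.e. an injective ring map `R → A` with `A`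
integral over `R`) such that `A` is an integral domain, the ring `A` is local. -/
theorem henselian_iff_integral_extension_domain_isLocalRing
    {R : Type u} [CommRing R] [IsDomain R] [IsLocalRing R] :
    HenselianLocalRing R ↔
      ∀ (A : Type u) [CommRing A] [IsDomain A] [Algebra R A],
        Function.Injective (algebraMap R A) → Algebra.IsIntegral R A → IsLocalRing A :=
  ⟨fun _ _ _ _ _ _ _ ↦ HenselianLocalRing.isLocalRing_of_isIntegral (R := R),
    HenselianLocalRing.of_forall_isLocalRing⟩
end

section
/- Let (R, m, κ) be a local ring and let i : R → S be a ring homomorphism such that S is a local ring whose maximal ideal equals mS and such that the induced map on residue fields κ → S/mS is an isomorphism (these properties hold when S is the Henselization of R). Let φ : R → A be a ring homomorphism and let P be a prime ideal of A with φ⁻¹(P) = m. Then the fiber of the map Spec(A ⊗_R S) → Spec(A), induced by a ↦ a ⊗ 1, over P consists of exactly one point. -/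
open TensorProduct

/-- If every element of `S` is congruent modulo `m S` to one coming from `R`, and the ideal `P` of
`A` contains the image of `m`, then every element of `A ⊗[R] S` is congruent modulo the extension
of `P` to one coming from `A`. -/
lemma Algebra.TensorProduct.exists_sub_includeLeft_mem_map {R S A : Type*} [CommRing R]
    [CommRing S] [Algebra R S] [CommRing A] [Algebra R A] {m : Ideal R} {P : Ideal A}
    (hm : m ≤ P.comap (algebraMap R A))
    (hS : ∀ s : S, ∃ r : R, s - algebraMap R S r ∈ m.map (algebraMap R S)) (x : A ⊗[R] S) :
    ∃ a : A, x - includeLeftRingHom a ∈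
      P.map (includeLeftRingHom : A →+* A ⊗[R] S) := by
  have hle : m.map (algebraMap R S) ≤
      (P.map (includeLeftRingHom : A →+* A ⊗[R] S)).comap
        (includeRight : S →ₐ[R] A ⊗[R] S) := by
    rw [Ideal.map_le_iff_le_comap]
    intro r hr
    rw [Ideal.mem_comap, Ideal.mem_comap, AlgHom.commutes,
      Algebra.TensorProduct.algebraMap_apply]
    exact Ideal.mem_map_of_mem _ (hm hr)
  induction x using TensorProduct.induction_on with
  | zero => exact ⟨0, by simp⟩
  | tmul a s =>
    obtain ⟨r, hr⟩ := hS s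
    refine ⟨r • a, ?_⟩
    have h := Ideal.mul_mem_left _ (a ⊗ₜ[R] (1 : S)) (Ideal.mem_comap.mp (hle hr))
    simpa [TensorProduct.tmul_sub, mul_sub, Algebra.algebraMap_eq_smul_one,
      TensorProduct.smul_tmul'] using h
  | add x y hx hy =>
    obtain ⟨a, ha⟩ := hx
    obtain ⟨b, hb⟩ := hy
    exact ⟨a + b, by rw [map_add, add_sub_add_comm]; exact add_mem ha hb⟩

/-- If every element of `B` is congruent modulo the extension of `P` to one coming from `A`, then
an ideal of `B` contracting to `P` is determined by this. -/
lemma Ideal.eq_of_comap_eq_of_exists_sub_mem_map {A B : Type*} [CommRing A] [CommRing B]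
    {f : A →+* B} {P : Ideal A} (hf : ∀ x : B, ∃ a : A, x - f a ∈ P.map f)
    {Q Q' : Ideal B} (hQ : Q.comap f = P) (hQ' : Q'.comap f = P) : Q = Q' := by
  have mem_iff {J : Ideal B} (hJ : J.comap f = P) {x : B} {a : A} (hx : x - f a ∈ P.map f) :
      x ∈ J ↔ a ∈ P := by
    have hxJ : x - f a ∈ J := Ideal.map_le_iff_le_comap.mpr hJ.ge hx
    rw [← hJ, Ideal.mem_comap, ← J.add_mem_iff_right hxJ (b := f a), sub_add_cancel]
  ext x
  obtain ⟨a, ha⟩ := hf x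
  rw [mem_iff hQ ha, mem_iff hQ' ha]

/-- Let `(R, m, κ)` be a local ring and `i : R → S` a ring map with `S` local,
whose maximal ideal is `m S`, and such that the induced map on residue fields `κ → S/mS` is an
isomorphism (encoded here as: the composite `R → S → S/m_S` is surjective with kernel `m`).
These properties hold when `S` is the Henselization of `R`.  Let `φ : R → A` be a ring map and
`P` a prime ideal of `A` with `φ⁻¹(P) = m`.  Then the fiber of
`Spec (A ⊗[R] S) → Spec A` (induced by `a ↦ a ⊗ 1`) over `P` consists of exactly one point. -/
theorem fiber_over_prime_lying_over_maximal_unique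
    {R S A : Type u} [CommRing R] [IsLocalRing R] [CommRing S] [IsLocalRing S]
    [Algebra R S]
    (hmax : IsLocalRing.maximalIdeal S =
      (IsLocalRing.maximalIdeal R).map (algebraMap R S))
    (hsurj : Function.Surjective
      ((Ideal.Quotient.mk (IsLocalRing.maximalIdeal S)).comp (algebraMap R S)))
    (hker : RingHom.ker
      ((Ideal.Quotient.mk (IsLocalRing.maximalIdeal S)).comp (algebraMap R S)) =
      IsLocalRing.maximalIdeal R)
    [CommRing A] [Algebra R A]
    (P : Ideal A) (hP : P.IsPrime)
    (hPm : P.comap (algebraMap R A) = IsLocalRing.maximalIdeal R) :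
    ∃! Q : Ideal (A ⊗[R] S), Q.IsPrime ∧
      Q.comap (Algebra.TensorProduct.includeLeftRingHom : A →+* A ⊗[R] S) = P := by
  have hS (s : S) : ∃ r : R,
      s - algebraMap R S r ∈ (IsLocalRing.maximalIdeal R).map (algebraMap R S) := by
    obtain ⟨r, hr⟩ := hsurj (Ideal.Quotient.mk _ s)
    exact ⟨r, hmax ▸ Ideal.Quotient.eq.mp hr.symm⟩
  have hle : RingHom.ker ((Ideal.Quotient.mk (IsLocalRing.maximalIdeal S)).comp
      (algebraMap R S)) ≤ RingHom.ker (algebraMap R (A ⧸ P)) := by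
    intro r hr
    rw [hker, ← hPm, Ideal.mem_comap] at hr
    rw [RingHom.mem_ker, IsScalarTower.algebraMap_apply R A (A ⧸ P)]
    exact Ideal.Quotient.eq_zero_iff_mem.mpr hr
  let g : S →ₐ[R] A ⧸ P :=
    { toRingHom := (RingHom.liftOfSurjective _ hsurj ⟨algebraMap R (A ⧸ P), hle⟩).comp
        (Ideal.Quotient.mk (IsLocalRing.maximalIdeal S))
      commutes' := fun r ↦ RingHom.liftOfRightInverse_comp_apply _ _
        (Function.rightInverse_surjInv hsurj)
        ⟨algebraMap R (A ⧸ P), hle⟩ r }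
  let F : A ⊗[R] S →ₐ[R] A ⧸ P :=
    Algebra.TensorProduct.lift (Ideal.Quotient.mkₐ R P) g fun _ _ ↦ Commute.all _ _
  have hF : (RingHom.ker F).comap
      (Algebra.TensorProduct.includeLeftRingHom : A →+* A ⊗[R] S) = P := by
    ext a
    simp [F, RingHom.mem_ker, Ideal.Quotient.eq_zero_iff_mem]
  refine ⟨RingHom.ker F, ⟨RingHom.ker_isPrime F, hF⟩, fun Q hQ ↦ ?_⟩
  exact Ideal.eq_of_comap_eq_of_exists_sub_mem_map
    (Algebra.TensorProduct.exists_sub_includeLeft_mem_map hPm.ge hS) hQ.2 hF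
end

section
/- Let (R, m, κ) be a local ring and let i : R → S be a faithfully flat ring homomorphism such that S is a local ring whose maximal ideal m_S equals mS and such that the induced map on residue fields κ → S/mS is an isomorphism (these properties hold when S is the Henselization of R). Let φ : R → A be an integral ring homomorphism and let Q be a prime ideal of A ⊗_R S. Then the following are equivalent: (a) Q is a maximal ideal of A ⊗_R S; (b) the contraction of Q to A (along a ↦ a ⊗ 1) is a maximal ideal of A; (c) the contraction of Q to S (along s ↦ 1 ⊗ s) equals m_S. -/
open TensorProduct

/-- Let `(R, m, κ)` be a local ring and `i : R → S` a faithfully flat ring map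
with `S` local, whose maximal ideal `m_S` equals `m S`, and such that the induced map on residue
fields `κ → S/mS` is an isomorphism (encoded as: the composite `R → S → S/m_S` is surjective
with kernel `m`).  These properties hold when `S` is the Henselization of `R`.  Let `φ : R → A`
be an integral ring map and `Q` a prime ideal of `A ⊗[R] S`.  Then the following are
equivalent: (a) `Q` is maximal; (b) the contraction of `Q` to `A` is maximal; (c) the
contraction of `Q` to `S` is `m_S`. -/
theorem tfae_maximal_of_base_change_along_henselization
    {R S A : Type u} [CommRing R] [IsLocalRing R] [CommRing S] [IsLocalRing S]
    [Algebra R S] [Module.FaithfullyFlat R S]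
    (hmax : IsLocalRing.maximalIdeal S =
      (IsLocalRing.maximalIdeal R).map (algebraMap R S))
    (hsurj : Function.Surjective
      ((Ideal.Quotient.mk (IsLocalRing.maximalIdeal S)).comp (algebraMap R S)))
    (hker : RingHom.ker
      ((Ideal.Quotient.mk (IsLocalRing.maximalIdeal S)).comp (algebraMap R S)) =
      IsLocalRing.maximalIdeal R)
    [CommRing A] [Algebra R A] (hint : Algebra.IsIntegral R A)
    (Q : Ideal (A ⊗[R] S)) (hQ : Q.IsPrime) :
    List.TFAE
      [Q.IsMaximal,
       (Q.comap (Algebra.TensorProduct.includeLeftRingHom : A →+* A ⊗[R] S)).IsMaximal,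
       Q.comap (Algebra.TensorProduct.includeRight : S →ₐ[R] A ⊗[R] S).toRingHom =
         IsLocalRing.maximalIdeal S] := by
  have hr : RingHom.IsIntegral
      (Algebra.TensorProduct.includeRight : S →ₐ[R] A ⊗[R] S).toRingHom := by
    intro x
    induction x with
    | zero => exact RingHom.isIntegralElem_zero _
    | add x y hx hy => exact RingHom.IsIntegralElem.add _ hx hy
    | tmul a s =>
      have ha : RingHom.IsIntegralElem
          (Algebra.TensorProduct.includeRight : S →ₐ[R] A ⊗[R] S).toRingHom (a ⊗ₜ[R] 1) := by
        have h₁ := (hint.isIntegral a).map (Algebra.TensorProduct.includeLeft : A →ₐ[R] A ⊗[R] S)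
        refine RingHom.IsIntegralElem.of_comp (f := algebraMap R S) ?_
        rw [show (Algebra.TensorProduct.includeRight : S →ₐ[R] A ⊗[R] S).toRingHom.comp
          (algebraMap R S) = algebraMap R (A ⊗[R] S) from
          (Algebra.TensorProduct.includeRight : S →ₐ[R] A ⊗[R] S).comp_algebraMap]
        exact h₁
      have hs := RingHom.isIntegralElem_map
        (Algebra.TensorProduct.includeRight : S →ₐ[R] A ⊗[R] S).toRingHom (x := s)
      simpa using RingHom.IsIntegralElem.mul _ ha hs
  have hcomap : (Q.comap (Algebra.TensorProduct.includeLeftRingHom : A →+* A ⊗[R] S)).comap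
      (algebraMap R A) = (Q.comap (Algebra.TensorProduct.includeRight :
        S →ₐ[R] A ⊗[R] S).toRingHom).comap (algebraMap R S) := by
    rw [Ideal.comap_comap, Ideal.comap_comap]
    exact congrArg (Ideal.comap · Q) Algebra.TensorProduct.includeLeftRingHom_comp_algebraMap
  tfae_have 1 → 3 := fun _ =>
    IsLocalRing.eq_maximalIdeal (Ideal.isMaximal_comap_of_isIntegral_of_isMaximal' _ hr Q)
  tfae_have 3 → 1 := fun h =>
    Ideal.isMaximal_of_isIntegral_of_isMaximal_comap' _ hr Q (h ▸ inferInstance)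
  tfae_have 3 → 2 := fun h => by
    have : (Q.comap (Algebra.TensorProduct.includeLeftRingHom : A →+* A ⊗[R] S)).IsPrime :=
      Ideal.comap_isPrime _ _
    refine Ideal.isMaximal_of_isIntegral_of_isMaximal_comap (R := R) _ ?_
    rw [hcomap, h, ← Ideal.mk_ker (I := IsLocalRing.maximalIdeal S), RingHom.comap_ker, hker]
    infer_instance
  tfae_have 2 → 3 := fun h => by
    have h₁ := IsLocalRing.eq_maximalIdeal (Ideal.isMaximal_comap_of_isIntegral_of_isMaximal
      (R := R) (Q.comap (Algebra.TensorProduct.includeLeftRingHom : A →+* A ⊗[R] S)))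
    have : (Q.comap (Algebra.TensorProduct.includeRight : S →ₐ[R] A ⊗[R] S).toRingHom).IsPrime :=
      Ideal.comap_isPrime _ _
    refine le_antisymm (IsLocalRing.le_maximalIdeal Ideal.IsPrime.ne_top') ?_
    rw [hmax, Ideal.map_le_iff_le_comap, ← hcomap, h₁]
  tfae_finish
end

section
/- Let (R, m, κ) be a local ring and let i : R → S be a faithfully flat ring homomorphism such that S is a local ring whose maximal ideal equals mS and such that the induced map on residue fields κ → S/mS is an isomorphism (these properties hold when S is the Henselization of R). Let φ : R → A be an integral ring homomorphism. Then for every maximal ideal M of A, there is exactly one prime ideal of A ⊗_R S contracting to M, and the contraction map Q ↦ Q ∩ A induces a bijection between the set of maximal ideals of A ⊗_R S and the set of maximal ideals of A. -/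
open TensorProduct

/-- If `m S` is the maximal ideal of `S` and `R → S / m_S` is surjective, then `A` surjects onto every
quotient of `A ⊗[R] S` in which `m` dies. -/
theorem surjective_quotient_comp_includeLeft_of_maximalIdeal_le
    {R S A : Type*} [CommRing R] [IsLocalRing R] [CommRing S] [IsLocalRing S] [Algebra R S]
    (hmax : IsLocalRing.maximalIdeal S =
      (IsLocalRing.maximalIdeal R).map (algebraMap R S))
    (hsurj : Function.Surjective
      ((Ideal.Quotient.mk (IsLocalRing.maximalIdeal S)).comp (algebraMap R S)))
    [CommRing A] [Algebra R A] {Q : Ideal (A ⊗[R] S)}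
    (hQ : IsLocalRing.maximalIdeal R ≤ Q.comap (algebraMap R (A ⊗[R] S))) :
    Function.Surjective ((Ideal.Quotient.mk Q).comp
      (Algebra.TensorProduct.includeLeftRingHom : A →+* A ⊗[R] S)) := by
  intro t
  obtain ⟨t, rfl⟩ := Ideal.Quotient.mk_surjective t
  induction t with
  | zero => exact ⟨0, by simp⟩
  | add x y hx hy =>
    obtain ⟨a, ha⟩ := hx
    obtain ⟨b, hb⟩ := hy
    exact ⟨a + b, by rw [map_add, ha, hb, map_add]⟩
  | tmul a s =>
    obtain ⟨r, hr⟩ := hsurj (Ideal.Quotient.mk _ s)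
    have hs : algebraMap R S r - s ∈ IsLocalRing.maximalIdeal S := Ideal.Quotient.eq.mp hr
    have hle : IsLocalRing.maximalIdeal S ≤
        Q.comap (Algebra.TensorProduct.includeRight : S →ₐ[R] A ⊗[R] S) := by
      rw [hmax, Ideal.map_le_iff_le_comap]
      intro x hx
      simpa only [Ideal.mem_comap, AlgHom.commutes] using hQ hx
    refine ⟨r • a, Ideal.Quotient.eq.mpr ?_⟩
    have h : (r • a) ⊗ₜ[R] (1 : S) - a ⊗ₜ[R] s =
        (a ⊗ₜ[R] (1 : S)) * ((1 : A) ⊗ₜ[R] (algebraMap R S r - s)) := by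
      rw [Algebra.TensorProduct.tmul_mul_tmul, mul_one, one_mul, TensorProduct.tmul_sub,
        TensorProduct.smul_tmul, Algebra.algebraMap_eq_smul_one]
    exact h ▸ Q.mul_mem_left _ (hle hs)

/-- Let `(R, m, κ)` be a local ring and `i : R → S` a faithfully flat ring map
with `S` local, whose maximal ideal equals `m S`, and such that the induced map on residue
fields `κ → S/mS` is an isomorphism (encoded as: the composite `R → S → S/m_S` is surjective
with kernel `m`).  These properties hold when `S` is the Henselization of `R`.  Let `φ : R → A`
be an integral ring map.  Then for every maximal ideal `M` of `A` there is exactly one prime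
ideal of `A ⊗[R] S` contracting to `M`, and contraction `Q ↦ Q ∩ A` is a bijection from the set
of maximal ideals of `A ⊗[R] S` onto the set of maximal ideals of `A`. -/
theorem maximal_ideals_bijection_of_base_change_along_henselization
    {R S A : Type u} [CommRing R] [IsLocalRing R] [CommRing S] [IsLocalRing S]
    [Algebra R S] [Module.FaithfullyFlat R S]
    (hmax : IsLocalRing.maximalIdeal S =
      (IsLocalRing.maximalIdeal R).map (algebraMap R S))
    (hsurj : Function.Surjective
      ((Ideal.Quotient.mk (IsLocalRing.maximalIdeal S)).comp (algebraMap R S)))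
    (hker : RingHom.ker
      ((Ideal.Quotient.mk (IsLocalRing.maximalIdeal S)).comp (algebraMap R S)) =
      IsLocalRing.maximalIdeal R)
    [CommRing A] [Algebra R A] (hint : Algebra.IsIntegral R A) :
    (∀ M : Ideal A, M.IsMaximal →
        ∃! Q : Ideal (A ⊗[R] S), Q.IsPrime ∧
          Q.comap (Algebra.TensorProduct.includeLeftRingHom : A →+* A ⊗[R] S) = M) ∧
      Set.BijOn
        (fun Q : Ideal (A ⊗[R] S) =>
          Q.comap (Algebra.TensorProduct.includeLeftRingHom : A →+* A ⊗[R] S))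
        {Q : Ideal (A ⊗[R] S) | Q.IsMaximal} {M : Ideal A | M.IsMaximal} := by
  let f : A →+* A ⊗[R] S := Algebra.TensorProduct.includeLeftRingHom
  have surj_of_comap {Q : Ideal (A ⊗[R] S)} (hQ : (Q.comap f).IsMaximal) :
      Function.Surjective ((Ideal.Quotient.mk Q).comp f) := by
    have hR : ((Q.comap f).comap (algebraMap R A)).IsMaximal :=
      Ideal.isMaximal_comap_of_isIntegral_of_isMaximal _
    exact surjective_quotient_comp_includeLeft_of_maximalIdeal_le hmax hsurj
      (IsLocalRing.eq_maximalIdeal hR).ge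
  have inf_eq_of_comap_eq {Q Q' : Ideal (A ⊗[R] S)} (hQ : (Q.comap f).IsMaximal)
      (h : Q.comap f = Q'.comap f) : Q ⊓ Q' = Q := by
    have hinf : (Q ⊓ Q').comap f = Q.comap f := by rw [Ideal.comap_inf, ← h, inf_idem]
    refine le_antisymm inf_le_left fun t ht => ?_
    obtain ⟨a, ha⟩ := surj_of_comap (hinf ▸ hQ) (Ideal.Quotient.mk _ t)
    have hat : f a - t ∈ Q ⊓ Q' := Ideal.Quotient.eq.mp ha
    have haQ : a ∈ Q.comap f := (Submodule.sub_mem_iff_left Q ht).mp hat.1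
    exact (Submodule.sub_mem_iff_right (Q ⊓ Q') (hinf.ge haQ)).mp hat
  have eq_of_comap_eq {Q Q' : Ideal (A ⊗[R] S)} (hQ : (Q.comap f).IsMaximal)
      (h : Q.comap f = Q'.comap f) : Q = Q' :=
    (inf_eq_of_comap_eq hQ h).symm.trans
      ((inf_comm Q Q').trans (inf_eq_of_comap_eq (h ▸ hQ) h.symm))
  have exists_prime (M : Ideal A) (hM : M.IsMaximal) :
      ∃ Q : Ideal (A ⊗[R] S), Q.IsPrime ∧ Q.comap f = M := by
    obtain ⟨Q, hQ⟩ := PrimeSpectrum.comap_surjective_of_faithfullyFlat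
      (A := A) (B := A ⊗[R] S) ⟨M, hM.isPrime⟩
    exact ⟨Q.asIdeal, Q.isPrime, congrArg PrimeSpectrum.asIdeal hQ⟩
  have comap_isMaximal {Q : Ideal (A ⊗[R] S)} (hQ : Q.IsMaximal) : (Q.comap f).IsMaximal := by
    have hS : (Q.comap (Algebra.TensorProduct.includeRight : S →ₐ[R] A ⊗[R] S)).IsMaximal := by
      refine Ideal.isMaximal_comap_of_isIntegral_of_isMaximal'
        (Algebra.TensorProduct.includeRight : S →ₐ[R] A ⊗[R] S).toRingHom ?_ Q
      have hcomm : ((Algebra.TensorProduct.comm R S A : S ⊗[R] A ≃+* A ⊗[R] S) :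
          S ⊗[R] A →+* A ⊗[R] S).comp (algebraMap S (S ⊗[R] A)) =
          (Algebra.TensorProduct.includeRight : S →ₐ[R] A ⊗[R] S).toRingHom := by
        ext s
        simp [Algebra.TensorProduct.algebraMap_apply]
      rw [← hcomm]
      exact RingHom.IsIntegral.trans _ _
        (algebraMap_isIntegral_iff.mpr inferInstance)
        (RingHom.isIntegral_of_surjective _ (RingEquiv.surjective _))
    have hle : IsLocalRing.maximalIdeal R ≤ Q.comap (algebraMap R (A ⊗[R] S)) := by
      intro r hr
      have h := (IsLocalRing.eq_maximalIdeal hS).ge (hmax ▸ Ideal.mem_map_of_mem _ hr)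
      simpa only [Ideal.mem_comap, AlgHom.commutes] using h
    have hsurjQ : Function.Surjective ((Ideal.Quotient.mk Q).comp f) :=
      surjective_quotient_comp_includeLeft_of_maximalIdeal_le hmax hsurj hle
    let := Ideal.Quotient.field Q
    have hker := RingHom.ker_isMaximal_of_surjective _ hsurjQ
    rwa [← RingHom.comap_ker, Ideal.mk_ker] at hker
  refine ⟨fun M hM => ?_, fun Q hQ => comap_isMaximal hQ,
    fun Q hQ Q' _ h => eq_of_comap_eq (comap_isMaximal hQ) h, fun M hM => ?_⟩
  · obtain ⟨Q, hQ, hQM⟩ := exists_prime M hM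
    exact ⟨Q, ⟨hQ, hQM⟩, fun Q' h => eq_of_comap_eq (h.2 ▸ hM) (h.2.trans hQM.symm)⟩
  · obtain ⟨Q, hQ, rfl⟩ := exists_prime M hM
    obtain ⟨N, hN, hQN⟩ := Q.exists_le_maximal hQ.ne_top
    have h : Q.comap f = N.comap f :=
      hM.eq_of_le (comap_isMaximal hN).ne_top (Ideal.comap_mono hQN)
    exact ⟨N, hN, h.symm⟩
end

section
/- Let R be an integral domain, let R ⊆ A be an integral extension with A an integral domain, and let S be an integral domain which is a flat R-algebra such that the structure map R → S is injective and Frac(S) is an algebraic extension of Frac(R). Let Q be a prime ideal of A ⊗_R S. Then the following are equivalent: (a) Q is a minimal prime ideal of A ⊗_R S; (b) the contraction of Q to A (along a ↦ a ⊗ 1) is the zero ideal; (c) the contraction of Q to S (along s ↦ 1 ⊗ s) is the zero ideal. -/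
open TensorProduct

theorem Ideal.comap_algebraMap_eq_bot_of_comap_eq_bot {R A B : Type*} [CommRing R] [CommRing A]
    [CommRing B] [Algebra R A] [Algebra R B] (f : A →ₐ[R] B)
    (hinj : Function.Injective (algebraMap R A)) {Q : Ideal B} (hQ : Q.comap f.toRingHom = ⊥) :
    Q.comap (algebraMap R B) = ⊥ := by
  rw [← f.comp_algebraMap, ← Ideal.comap_comap]
  exact (congrArg (Ideal.comap (algebraMap R A)) hQ).trans
    ((RingHom.injective_iff_ker_eq_bot _).mp hinj)

theorem Ideal.comap_eq_bot_of_comap_algebraMap_eq_bot {R A B : Type*} [CommRing R] [CommRing A]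
    [IsDomain A] [CommRing B] [Algebra R A] [Algebra R B] [Algebra.IsAlgebraic R A]
    (f : A →ₐ[R] B) {Q : Ideal B} (hQ : Q.comap (algebraMap R B) = ⊥) :
    Q.comap f.toRingHom = ⊥ := by
  by_contra h
  obtain ⟨x, hx, hx0⟩ := Submodule.exists_mem_ne_zero_of_ne_bot h
  refine Ideal.comap_ne_bot_of_algebraic_mem hx0 hx (Algebra.IsAlgebraic.isAlgebraic (R := R) x) ?_
  rw [Ideal.comap_comap]
  exact (congrArg (Q.comap ·) f.comp_algebraMap).trans hQ

theorem Ideal.mem_minimalPrimes_of_comap_eq_bot {S B : Type*} [CommRing S] [CommRing B]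
    (f : S →+* B) (hf : f.IsIntegral) {Q : Ideal B} (hQ : Q.IsPrime) (h : Q.comap f = ⊥) :
    Q ∈ minimalPrimes B := by
  algebraize [f]
  refine ⟨⟨hQ, bot_le⟩, fun P ⟨hP, _⟩ hPQ => ?_⟩
  by_contra hne
  have hlt := Ideal.IsIntegral.comap_lt_comap (R := S) (lt_of_le_not_ge hPQ hne)
  exact not_lt_bot (hlt.trans_eq h)

theorem Algebra.TensorProduct.isIntegral_includeRight {R A S : Type*} [CommRing R] [CommRing A]
    [CommRing S] [Algebra R A] [Algebra R S] [Algebra.IsIntegral R A] :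
    (includeRight : S →ₐ[R] A ⊗[R] S).toRingHom.IsIntegral := by
  have h : (algebraMap S (S ⊗[R] A)).IsIntegral := Algebra.IsIntegral.isIntegral
  have h' := h.trans _ _ (RingHom.isIntegral_of_surjective
    (Algebra.TensorProduct.comm R S A : S ⊗[R] A →+* A ⊗[R] S)
    (Algebra.TensorProduct.comm R S A).surjective)
  have heq : (Algebra.TensorProduct.comm R S A : S ⊗[R] A →+* A ⊗[R] S).comp
      (algebraMap S (S ⊗[R] A)) = (includeRight : S →ₐ[R] A ⊗[R] S).toRingHom := by
    ext x
    simp [Algebra.TensorProduct.algebraMap_apply]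
  exact heq ▸ h'

theorem Algebra.TensorProduct.comap_includeLeftRingHom_eq_bot_of_mem_minimalPrimes
    {R A S : Type*} [CommRing R] [CommRing A] [IsDomain A] [CommRing S] [Algebra R A]
    [Algebra R S] [Module.Flat R S] {Q : Ideal (A ⊗[R] S)} (hQ : Q ∈ minimalPrimes (A ⊗[R] S)) :
    Q.comap (includeLeftRingHom : A →+* A ⊗[R] S) = ⊥ := by
  refine (Submodule.eq_bot_iff _).mpr fun a ha => ?_
  by_contra ha0
  refine notMem_nonZeroDivisors_of_mem_mem_minimalPrimes (Ideal.mem_comap.mp ha) hQ ?_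
  rw [mem_nonZeroDivisors_iff_right]
  intro z hz
  refine (Module.Flat.isSMulRegular_of_nonZeroDivisors (M := A ⊗[R] S)
    (mem_nonZeroDivisors_of_ne_zero ha0)).right_eq_zero_of_smul ?_
  rw [Algebra.smul_def, mul_comm]
  exact hz

/-- Let `R` be an integral domain, `R ⊆ A` an integral extension with `A` a
domain, and `S` a domain which is a flat `R`-algebra with injective structure map such that
`Frac S` is an algebraic extension of `Frac R` (these hypotheses on `S` hold when `S` is the
Henselization of a local integrally closed domain `R`).  Let `Q` be a prime ideal of
`A ⊗[R] S`.  Then the following are equivalent: (a) `Q` is a minimal prime of `A ⊗[R] S`;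
(b) the contraction of `Q` to `A` is the zero ideal; (c) the contraction of `Q` to `S` is the
zero ideal. -/
theorem tfae_minimal_prime_of_base_change
    {R A S K L : Type u} [CommRing R] [IsDomain R]
    [CommRing A] [IsDomain A] [Algebra R A]
    (hAinj : Function.Injective (algebraMap R A)) (hAint : Algebra.IsIntegral R A)
    [CommRing S] [IsDomain S] [Algebra R S] [Module.Flat R S]
    (hSinj : Function.Injective (algebraMap R S))
    [Field K] [Algebra R K] [IsFractionRing R K]
    [Field L] [Algebra S L] [IsFractionRing S L]
    [Algebra R L] [IsScalarTower R S L]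
    [Algebra K L] [IsScalarTower R K L]
    (halg : Algebra.IsAlgebraic K L)
    (Q : Ideal (A ⊗[R] S)) (hQ : Q.IsPrime) :
    List.TFAE
      [Q ∈ minimalPrimes (A ⊗[R] S),
       Q.comap (Algebra.TensorProduct.includeLeftRingHom : A →+* A ⊗[R] S) = ⊥,
       Q.comap (Algebra.TensorProduct.includeRight : S →ₐ[R] A ⊗[R] S).toRingHom = ⊥] := by
  have hS : Algebra.IsAlgebraic R S := by
    have := (IsFractionRing.comap_isAlgebraic_iff (A := R) (K := K) (C := L)).mpr halg
    exact ⟨fun x => (isAlgebraic_algHom_iff (IsScalarTower.toAlgHom R S L)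
      (IsFractionRing.injective S L)).mp (Algebra.IsAlgebraic.isAlgebraic _)⟩
  tfae_have 1 → 2 := Algebra.TensorProduct.comap_includeLeftRingHom_eq_bot_of_mem_minimalPrimes
  tfae_have 2 → 3 := fun h => Ideal.comap_eq_bot_of_comap_algebraMap_eq_bot _
    (Ideal.comap_algebraMap_eq_bot_of_comap_eq_bot
      (Algebra.TensorProduct.includeLeft : A →ₐ[R] A ⊗[R] S) hAinj h)
  tfae_have 3 → 1 := Ideal.mem_minimalPrimes_of_comap_eq_bot _
    Algebra.TensorProduct.isIntegral_includeRight hQ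
  tfae_finish
end

section
/- Let R be an integral domain, let R ⊆ A be an integral extension with A an integral domain, and let S be an integral domain which is a flat R-algebra such that the structure map R → S is injective and Frac(S) is an algebraic extension of Frac(R). Then the set of minimal prime ideals of A ⊗_R S is in bijection with Spec(Frac(A) ⊗_{Frac(R)} Frac(S)). In particular, if Frac(A) is a finite field extension of Frac(R), then A ⊗_R S has only finitely many minimal prime ideals. -/
open TensorProduct

open scoped nonZeroDivisors

/-- If a zero-dimensional ring `D` is a localization of `B` and `B` embeds in `D`, then the primes
of `D` correspond to the minimal primes of `B`. -/
noncomputable def minimalPrimesEquivOfIsLocalization {B D : Type*} [CommRing B] [CommRing D]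
    [Algebra B D] (M : Submonoid B) [IsLocalization M D] [Ring.KrullDimLE 0 D]
    (hinj : Function.Injective (algebraMap B D)) :
    minimalPrimes B ≃ PrimeSpectrum D :=
  have h : minimalPrimes B = Ideal.comap (algebraMap B D) '' {I : Ideal D | I.IsPrime} := by
    have hD : (⊥ : Ideal D).minimalPrimes = {I : Ideal D | I.IsPrime} :=
      Set.ext fun _ ↦ Ideal.mem_minimalPrimes_iff_isPrime
    rw [← hD, ← IsLocalization.minimalPrimes_comap M D ⊥, Ideal.comap_bot_of_injective _ hinj]
  (Equiv.setCongr h).trans <|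
    (Equiv.Set.image _ _ (Function.LeftInverse.injective (IsLocalization.map_under M D))).symm.trans
      (PrimeSpectrum.equivSubtype D).toEquiv.symm

/-- A base change of an algebraic field extension is zero-dimensional. -/
theorem krullDimLE_zero_tensorProduct_of_isAlgebraic (F K L : Type*) [Field K] [Field L] [Field F]
    [Algebra K L] [Algebra K F] [Algebra.IsAlgebraic K L] :
    Ring.KrullDimLE 0 (F ⊗[K] L) := by
  have : Algebra.IsIntegral K L := Algebra.isAlgebraic_iff_isIntegral.mp inferInstance
  refine .mk₀ fun I hI ↦ Ideal.isMaximal_of_isIntegral_of_isMaximal_comap (R := F) I ?_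
  have : (I.comap (algebraMap F (F ⊗[K] L))).IsPrime := hI.comap _
  infer_instance

/-- Fraction fields of algebraic extensions of a domain `R`, tensored over `R`, localize the tensor
product of the extensions at the nonzero elements of `R`. -/
theorem isLocalizedModule_map_toAlgHom_fractionRing (R A S F L : Type*) [CommRing R]
    [CommRing A] [IsDomain A] [Algebra R A] [FaithfulSMul R A] [Algebra.IsAlgebraic R A]
    [CommRing S] [IsDomain S] [Algebra R S] [FaithfulSMul R S] [Algebra.IsAlgebraic R S]
    [CommRing F] [Algebra A F] [IsFractionRing A F] [Algebra R F] [IsScalarTower R A F]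
    [CommRing L] [Algebra S L] [IsFractionRing S L] [Algebra R L] [IsScalarTower R S L] :
    IsLocalizedModule R⁰ (Algebra.TensorProduct.map (IsScalarTower.toAlgHom R A F)
      (IsScalarTower.toAlgHom R S L)).toLinearMap :=
  inferInstanceAs (IsLocalizedModule R⁰ (TensorProduct.map
    (IsScalarTower.toAlgHom R A F).toLinearMap (IsScalarTower.toAlgHom R S L).toLinearMap))

/-- Let `R` be an integral domain, `R ⊆ A` an integral extension with `A` a
domain, and `S` a domain which is a flat `R`-algebra with injective structure map such that
`L = Frac S` is an algebraic extension of `K = Frac R` (these hypotheses on `S` hold when `S`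
is the Henselization of a local integrally closed domain `R`).  Let `F = Frac A`.  Then the set
of minimal primes of `A ⊗[R] S` is in bijection with `Spec (F ⊗[K] L)`; in particular, if `F`
is a finite field extension of `K` then `A ⊗[R] S` has only finitely many minimal primes. -/
theorem minimalPrimes_base_change_equiv_primeSpectrum
    {R A S K L F : Type u} [CommRing R] [IsDomain R]
    [CommRing A] [IsDomain A] [Algebra R A]
    (hAinj : Function.Injective (algebraMap R A)) (hAint : Algebra.IsIntegral R A)
    [CommRing S] [IsDomain S] [Algebra R S] [Module.Flat R S]
    (hSinj : Function.Injective (algebraMap R S))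
    [Field K] [Algebra R K] [IsFractionRing R K]
    [Field L] [Algebra S L] [IsFractionRing S L]
    [Algebra R L] [IsScalarTower R S L]
    [Algebra K L] [IsScalarTower R K L]
    (halg : Algebra.IsAlgebraic K L)
    [Field F] [Algebra A F] [IsFractionRing A F]
    [Algebra R F] [IsScalarTower R A F]
    [Algebra K F] [IsScalarTower R K F] :
    Nonempty ((minimalPrimes (A ⊗[R] S)) ≃ PrimeSpectrum (F ⊗[K] L)) ∧
      (Module.Finite K F → (minimalPrimes (A ⊗[R] S)).Finite) := by
  have : FaithfulSMul R A := (faithfulSMul_iff_algebraMap_injective R A).mpr hAinj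
  have : FaithfulSMul R S := (faithfulSMul_iff_algebraMap_injective R S).mpr hSinj
  have : FaithfulSMul R L := .trans R S L
  have : Algebra.IsAlgebraic R L := (IsFractionRing.comap_isAlgebraic_iff (K := K)).mpr halg
  have : Algebra.IsAlgebraic R S := (IsFractionRing.isAlgebraic_iff' R S L).mpr inferInstance
  let f := Algebra.TensorProduct.map (IsScalarTower.toAlgHom R A F) (IsScalarTower.toAlgHom R S L)
  have hf : IsLocalizedModule R⁰ f.toLinearMap :=
    isLocalizedModule_map_toAlgHom_fractionRing R A S F L
  let _ : Algebra (A ⊗[R] S) (F ⊗[R] L) := f.toRingHom.toAlgebra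
  have : IsScalarTower R (A ⊗[R] S) (F ⊗[R] L) := .of_algebraMap_eq' f.comp_algebraMap.symm
  have : IsLocalization (Algebra.algebraMapSubmonoid (A ⊗[R] S) R⁰) (F ⊗[R] L) :=
    isLocalizedModule_iff_isLocalization.mp hf
  have hreg : Function.Injective f := by
    refine (IsLocalizedModule.injective_iff_isRegular (S := R⁰) f.toLinearMap).mpr fun r ↦ ?_
    have hr : Function.Injective (LinearMap.lsmul R A r) := fun a b h ↦ by
      simpa [Algebra.smul_def, (map_ne_zero_iff _ hAinj).mpr (nonZeroDivisors.coe_ne_zero r)] using h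
    convert! Module.Flat.rTensor_preserves_injective_linearMap (M := S) _ hr
  let e := IsLocalization.algebraTensorEquiv R⁰ K F L
  have : Ring.KrullDimLE 0 (F ⊗[K] L) := krullDimLE_zero_tensorProduct_of_isAlgebraic F K L
  have : Ring.KrullDimLE 0 (F ⊗[R] L) := .mk₀ fun I hI ↦
    (Ideal.isMaximal_comap_iff_of_bijective e e.bijective).mp (hI.comap e).isMaximal'
  let E : minimalPrimes (A ⊗[R] S) ≃ PrimeSpectrum (F ⊗[K] L) :=
    (minimalPrimesEquivOfIsLocalization (Algebra.algebraMapSubmonoid (A ⊗[R] S) R⁰) hreg).trans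
      (PrimeSpectrum.comapEquiv e.toRingEquiv.symm).toEquiv
  refine ⟨⟨E⟩, fun _ ↦ ?_⟩
  have : IsArtinianRing (L ⊗[K] F) := IsArtinianRing.of_finite L _
  have : IsArtinianRing (F ⊗[K] L) :=
    (Algebra.TensorProduct.comm K L F).toRingEquiv.surjective.isArtinianRing
  exact (Equiv.finite_iff E).mpr inferInstance
end

section
/- Let A be a commutative ring such that for every maximal ideal m of A, the localization A_m is an integral domain. If p and q are distinct minimal prime ideals of A, then p + q = A. -/
/-- If `A_m` is a domain, any minimal prime contained in `m` is the kernel of `A → A_m`. -/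
theorem eq_ker_algebraMap_of_mem_minimalPrimes_of_le {A : Type*} [CommRing A]
    {m p : Ideal A} [m.IsPrime] [IsDomain (Localization m.primeCompl)]
    (hp : p ∈ minimalPrimes A) (hpm : p ≤ m) :
    p = RingHom.ker (algebraMap A (Localization m.primeCompl)) := by
  have hle : RingHom.ker (algebraMap A (Localization m.primeCompl)) ≤ p := by
    intro x hx
    obtain ⟨s, hs⟩ := (IsLocalization.map_eq_zero_iff m.primeCompl _ x).1 hx
    have hsx : (s : A) * x ∈ p := hs ▸ p.zero_mem
    exact (hp.1.1.mem_or_mem hsx).resolve_left fun h => s.2 (hpm h)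
  exact le_antisymm (hp.2 ⟨RingHom.ker_isPrime _, bot_le⟩ hle) hle

/-- Let `A` be a commutative ring such that for every maximal ideal `m` of
`A`, the localization `A_m` is an integral domain.  If `p` and `q` are distinct minimal primes
of `A`, then `p + q = A`. -/
theorem minimal_primes_comaximal_of_locally_domain
    {A : Type u} [CommRing A]
    (hloc : ∀ (m : Ideal A) (hm : m.IsMaximal),
      IsDomain (Localization (@Ideal.primeCompl A _ m hm.isPrime)))
    {p q : Ideal A} (hp : p ∈ minimalPrimes A) (hq : q ∈ minimalPrimes A)
    (hpq : p ≠ q) :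
    p ⊔ q = ⊤ := by
  by_contra h
  obtain ⟨m, hm, hle⟩ := Ideal.exists_le_maximal _ h
  have := hm.isPrime
  have := hloc m hm
  exact hpq ((eq_ker_algebraMap_of_mem_minimalPrimes_of_le hp (le_sup_left.trans hle)).trans
    (eq_ker_algebraMap_of_mem_minimalPrimes_of_le hq (le_sup_right.trans hle)).symm)
end

section
/- Let A be a commutative ring such that for every maximal ideal m of A, the localization A_m is an integral domain. If A has exactly n distinct minimal prime ideals p_1, …, p_n (finitely many), then the canonical map A → A/p_1 × ⋯ × A/p_n is a ring isomorphism. -/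
/-- If the localization of `A` at a prime `m` is a domain, then every minimal prime contained in
`m` is the kernel of the localization map. -/
theorem eq_ker_algebraMap_localization_of_mem_minimalPrimes {A : Type*} [CommRing A]
    (m : Ideal A) [m.IsPrime] [IsDomain (Localization m.primeCompl)]
    {p : Ideal A} (hp : p ∈ minimalPrimes A) (hpm : p ≤ m) :
    p = RingHom.ker (algebraMap A (Localization m.primeCompl)) := by
  have hker : RingHom.ker (algebraMap A (Localization m.primeCompl)) ≤ p := by
    intro x hx
    obtain ⟨s, hs⟩ := (IsLocalization.map_eq_zero_iff m.primeCompl _ x).mp hx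
    have hsx : (s : A) * x ∈ p := hs ▸ p.zero_mem
    exact (hp.1.1.mem_or_mem hsx).resolve_left fun h => s.2 (hpm h)
  exact le_antisymm (hp.2 ⟨RingHom.ker_isPrime _, bot_le⟩ hker) hker


/-- Let `A` be a commutative ring such that for every maximal ideal `m` of
`A`, the localization `A_m` is an integral domain.  If `A` has exactly `n` distinct minimal
primes `p 0, …, p (n-1)`, then the canonical map `A → A/p 0 × ⋯ × A/p (n-1)` is a ring
isomorphism (i.e. bijective). -/
theorem bijective_pi_quotient_minimalPrimes_of_locally_domain
    {A : Type u} [CommRing A]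
    (hloc : ∀ (m : Ideal A) (hm : m.IsMaximal),
      IsDomain (Localization (@Ideal.primeCompl A _ m hm.isPrime)))
    {n : ℕ} (p : Fin n → Ideal A) (hp_inj : Function.Injective p)
    (hp : minimalPrimes A = Set.range p) :
    Function.Bijective (Pi.ringHom fun i : Fin n => Ideal.Quotient.mk (p i)) := by
  have hmem (i : Fin n) : p i ∈ minimalPrimes A := hp ▸ Set.mem_range_self i
  refine ⟨?_, ?_⟩
  · have : IsReduced A := isReduced_ofLocalizationMaximal A fun m hm => by
      have := hloc m hm
      infer_instance
    rw [injective_iff_map_eq_zero]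
    intro x hx
    have hx' : x ∈ sInf (⊥ : Ideal A).minimalPrimes := by
      rw [Submodule.mem_sInf]
      intro q hq
      change q ∈ minimalPrimes A at hq
      rw [hp] at hq
      obtain ⟨i, rfl⟩ := hq
      exact Ideal.Quotient.eq_zero_iff_mem.mp (congrFun hx i)
    rw [Ideal.sInf_minimalPrimes] at hx'
    exact (mem_nilradical.mp hx').eq_zero
  · have hcop : Pairwise (Function.onFun IsCoprime p) := fun i j hij => by
      rw [Function.onFun, Ideal.isCoprime_iff_sup_eq]
      by_contra hne
      obtain ⟨m, hm, hle⟩ := Ideal.exists_le_maximal _ hne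
      have := hm.isPrime
      have := hloc m hm
      exact hij <| hp_inj <|
        (eq_ker_algebraMap_localization_of_mem_minimalPrimes m (hmem i)
          (le_sup_left.trans hle)).trans
        (eq_ker_algebraMap_localization_of_mem_minimalPrimes m (hmem j)
          (le_sup_right.trans hle)).symm
    intro y
    obtain ⟨x, hx⟩ := Ideal.pi_quotient_surjective hcop y
    exact ⟨x, funext hx⟩
end

section
/- Let (R, m) be a local domain that is integrally closed in its fraction field K, let L be a finite field extension of K, and let A be the integral closure of R in L, so that A has finitely many maximal ideals m_1, …, m_n (pairwise distinct). Let Σ be the collection of R-subalgebras B of A that are finitely generated as R-modules, satisfy Frac(B) = L, and satisfy m_i ∩ B ≠ m_j ∩ B for all i ≠ j. Then Σ is nonempty, Σ is directed (filtered) under inclusion, and A is the union of the members of Σ. -/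
/-- Ideals that are separated by a subalgebra are separated by every larger one. -/
lemma comap_inclusion_ne_mono {R L ι : Type*} [CommRing R] [Field L] [Algebra R L]
    (m : ι → Ideal ↥(integralClosure R L)) {B C : Subalgebra R L} (hBC : B ≤ C)
    (hB : B ≤ integralClosure R L) (hC : C ≤ integralClosure R L) {i j : ι}
    (h : (m i).comap (Subalgebra.inclusion hB).toRingHom ≠
      (m j).comap (Subalgebra.inclusion hB).toRingHom) :
    (m i).comap (Subalgebra.inclusion hC).toRingHom ≠
      (m j).comap (Subalgebra.inclusion hC).toRingHom := by
  intro e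
  apply h
  have := congrArg (Ideal.comap (Subalgebra.inclusion hBC).toRingHom) e
  rwa [Ideal.comap_comap, Ideal.comap_comap] at this

/-- A subalgebra containing a spanning set of `L` over `K = Frac R` has fraction field `L`. -/
lemma exists_div_of_span_eq_top {R L : Type*} (K : Type*) [CommRing R] [IsDomain R]
    [Field K] [Algebra R K] [IsFractionRing R K] [Field L] [Algebra K L] [Algebra R L]
    [IsScalarTower R K L] (B : Subalgebra R L) (hB : Submodule.span K (B : Set L) = ⊤) (x : L) :
    ∃ b ∈ B, ∃ c ∈ B, c ≠ 0 ∧ x = b / c := by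
  obtain ⟨t, ht⟩ := multiple_mem_span_of_mem_localization_span (nonZeroDivisors R) K
    (B : Set L) x (hB ▸ Submodule.mem_top)
  have hinj : Function.Injective (algebraMap R L) := by
    rw [IsScalarTower.algebraMap_eq R K L]
    exact (algebraMap K L).injective.comp (IsFractionRing.injective R K)
  have h0 : algebraMap R L t ≠ 0 := by
    rw [Ne, map_eq_zero_iff _ hinj]
    exact nonZeroDivisors.coe_ne_zero t
  have hmem : (t : R) • x ∈ B :=
    (Submodule.span_le.2 (le_refl (B : Set L)) :
      Submodule.span R (B : Set L) ≤ Subalgebra.toSubmodule B) ht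
  refine ⟨(t : R) • x, hmem, algebraMap R L t, B.algebraMap_mem _, h0, ?_⟩
  rw [Algebra.smul_def, mul_div_cancel_left₀ _ h0]

/-- A finite family of integral elements spans `L` over `K = Frac R`. -/
lemma exists_finite_integral_span_eq_top (R K L : Type*) [CommRing R] [IsDomain R]
    [Field K] [Algebra R K] [IsFractionRing R K] [Field L] [Algebra K L]
    [FiniteDimensional K L] [Algebra R L] [IsScalarTower R K L] :
    ∃ S : Set L, S.Finite ∧ (∀ x ∈ S, IsIntegral R x) ∧ Submodule.span K S = ⊤ := by
  obtain ⟨s, hs⟩ := (Module.Finite.fg_top : (⊤ : Submodule K L).FG)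
  have : Algebra.IsAlgebraic R L :=
    (IsFractionRing.comap_isAlgebraic_iff (A := R) (K := K) (C := L)).2 inferInstance
  obtain ⟨y, hy, hint⟩ := Algebra.IsAlgebraic.exists_integral_multiples (R := R) s
  refine ⟨(fun x => y • x) '' s, s.finite_toSet.image _, ?_, ?_⟩
  · rintro _ ⟨x, hx, rfl⟩
    exact hint x hx
  · rw [eq_top_iff, ← hs, Submodule.span_le]
    intro x hx
    have hy' : algebraMap R K y ≠ 0 := by
      rwa [Ne, map_eq_zero_iff _ (IsFractionRing.injective R K)]
    have h := Submodule.smul_mem _ (algebraMap R K y)⁻¹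
      (Submodule.subset_span (R := K) (Set.mem_image_of_mem (fun x => y • x) hx))
    rwa [← algebraMap_smul K y x, smul_smul, inv_mul_cancel₀ hy', one_smul] at h

/-- Let `(R, m)` be a local domain integrally closed in its fraction field
`K`, `L` a finite field extension of `K`, and `A = integralClosure R L` the integral closure of
`R` in `L`, with (pairwise distinct) maximal ideals `m 0, …, m (n-1)`.  Let `Σ` be the
collection of `R`-subalgebras `B` of `A` that are finitely generated as `R`-modules, satisfy
`Frac B = L`, and satisfy `m i ∩ B ≠ m j ∩ B` for `i ≠ j`.  Then `Σ` is nonempty, directed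
under inclusion, and `A` is the union of the members of `Σ`. -/
theorem integralClosure_eq_directed_union_of_finite_subalgebras
    {R K L : Type u} [CommRing R] [IsDomain R] [IsLocalRing R] [IsIntegrallyClosed R]
    [Field K] [Algebra R K] [IsFractionRing R K]
    [Field L] [Algebra K L] [FiniteDimensional K L]
    [Algebra R L] [IsScalarTower R K L]
    {n : ℕ} (m : Fin n → Ideal ↥(integralClosure R L))
    (hm_inj : Function.Injective m)
    (hm : {M : Ideal ↥(integralClosure R L) | M.IsMaximal} = Set.range m)
    (Sig : Set (Subalgebra R L))
    (hSig : Sig = {B : Subalgebra R L | ∃ hB : B ≤ integralClosure R L,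
      Module.Finite R ↥B ∧
      (∀ x : L, ∃ b ∈ B, ∃ c ∈ B, c ≠ 0 ∧ x = b / c) ∧
      ∀ i j : Fin n, i ≠ j →
        (m i).comap (Subalgebra.inclusion hB).toRingHom ≠
          (m j).comap (Subalgebra.inclusion hB).toRingHom}) :
    Sig.Nonempty ∧ DirectedOn (· ≤ ·) Sig ∧
      (↑(integralClosure R L) : Set L) = ⋃ B ∈ Sig, (B : Set L) := by
  have hmem (B : Subalgebra R L) : B ∈ Sig ↔ ∃ hB : B ≤ integralClosure R L,
      Module.Finite R ↥B ∧
      (∀ x : L, ∃ b ∈ B, ∃ c ∈ B, c ≠ 0 ∧ x = b / c) ∧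
      ∀ i j : Fin n, i ≠ j →
        (m i).comap (Subalgebra.inclusion hB).toRingHom ≠
          (m j).comap (Subalgebra.inclusion hB).toRingHom := by
    rw [hSig]
    rfl
  have hup {B C : Subalgebra R L} (hB : B ∈ Sig) (hBC : B ≤ C)
      (hC : C ≤ integralClosure R L) (hfin : Module.Finite R C) : C ∈ Sig := by
    obtain ⟨hB', -, hfrac, hsep⟩ := (hmem B).1 hB
    refine (hmem C).2 ⟨hC, hfin, fun x => ?_, fun i j hij =>
      comap_inclusion_ne_mono m hBC hB' hC (hsep i j hij)⟩
    obtain ⟨b, hb, c, hc, h0, h⟩ := hfrac x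
    exact ⟨b, hBC hb, c, hBC hc, h0, h⟩
  have hsup {B C : Subalgebra R L} (hB : B ∈ Sig) (hC : C ≤ integralClosure R L)
      (hfin : Module.Finite R C) : B ⊔ C ∈ Sig := by
    obtain ⟨hB', hBfin, -⟩ := (hmem B).1 hB
    exact hup hB le_sup_left (sup_le hB' hC) (Subalgebra.finite_sup B C)
  have hadj {S : Set L} (hS : S.Finite) (hint : ∀ x ∈ S, IsIntegral R x) :
      Algebra.adjoin R S ≤ integralClosure R L ∧ Module.Finite R (Algebra.adjoin R S) :=
    ⟨Algebra.adjoin_le hint, Algebra.finite_adjoin_of_finite_of_isIntegral hS hint⟩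
  have hne : Sig.Nonempty := by
    obtain ⟨S, hS, hSint, hSspan⟩ := exists_finite_integral_span_eq_top R K L
    have hmax (i : Fin n) : (m i).IsMaximal := by
      have : m i ∈ {M : Ideal ↥(integralClosure R L) | M.IsMaximal} := hm ▸ Set.mem_range_self i
      exact this
    have hex (i j : Fin n) : ∃ a : ↥(integralClosure R L), i ≠ j → a ∈ m i ∧ a ∉ m j := by
      by_cases hij : i = j
      · exact ⟨0, fun h => absurd hij h⟩
      · have hle : ¬ m i ≤ m j := fun h =>
          hij (hm_inj ((hmax i).eq_of_le (hmax j).ne_top h))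
        obtain ⟨a, ha, ha'⟩ := SetLike.not_le_iff_exists.1 hle
        exact ⟨a, fun _ => ⟨ha, ha'⟩⟩
    choose a ha using hex
    let T : Set L := S ∪ Set.range fun p : Fin n × Fin n => (a p.1 p.2 : L)
    obtain ⟨hle, hfin⟩ := hadj (S := T) (hS.union (Set.finite_range _)) (by
      rintro x (hx | ⟨p, rfl⟩)
      · exact hSint x hx
      · exact (a p.1 p.2).2)
    have hTsub : T ⊆ Algebra.adjoin R T := Algebra.subset_adjoin
    refine ⟨Algebra.adjoin R T, (hmem _).2 ⟨hle, hfin, ?_, fun i j hij e => ?_⟩⟩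
    · exact exists_div_of_span_eq_top K _ (eq_top_iff.2 (hSspan ▸
        Submodule.span_mono (Set.subset_union_left.trans hTsub)))
    · have haT : (a i j : L) ∈ Algebra.adjoin R T := hTsub (Or.inr ⟨(i, j), rfl⟩)
      have h : (⟨a i j, haT⟩ : Algebra.adjoin R T) ∈
          (m i).comap (Subalgebra.inclusion hle).toRingHom := (ha i j hij).1
      rw [e] at h
      exact (ha i j hij).2 h
  refine ⟨hne, fun B hB C hC => ?_, Set.Subset.antisymm (fun x hx => ?_) ?_⟩
  · obtain ⟨hC', hCfin, -⟩ := (hmem C).1 hC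
    exact ⟨B ⊔ C, hsup hB hC' hCfin, le_sup_left, le_sup_right⟩
  · obtain ⟨B, hB⟩ := hne
    obtain ⟨hle, hfin⟩ := hadj (Set.finite_singleton x) (by rintro _ rfl; exact hx)
    exact Set.mem_biUnion (hsup hB hle hfin)
      ((le_sup_right : _ ≤ B ⊔ Algebra.adjoin R {x}) (Algebra.self_mem_adjoin_singleton R x))
  · exact Set.iUnion₂_subset fun B hB => ((hmem B).1 hB).1
end

section
/- Let φ : V → W be a ring homomorphism where W is a valuation ring. Then the following are equivalent: (1) V is a valuation ring and φ is an injective local homomorphism; (2) φ is faithfully flat; (3) φ is cyclically pure, i.e., for every ideal I of V the induced map V/I → W/IW is injective. -/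
/-- Let `φ : V → W` be a ring homomorphism (here realized as the algebra map
of an algebra structure) where `W` is a valuation ring.  Then the following are equivalent:
(1) `V` is a valuation ring and `φ` is an injective local homomorphism;
(2) `φ` is faithfully flat;
(3) `φ` is cyclically pure, i.e. for every ideal `I` of `V` the induced map
`V/I → W/IW` is injective. -/
theorem tfae_valuation_descent
    {V W : Type u} [CommRing V] [CommRing W] [IsDomain W] [ValuationRing W]
    [Algebra V W] :
    List.TFAE
      [(∃ _h : IsDomain V, @ValuationRing V _ _h) ∧
         Function.Injective (algebraMap V W) ∧ IsLocalHom (algebraMap V W),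
       Module.FaithfullyFlat V W,
       ∀ I : Ideal V,
         Function.Injective
           (Ideal.quotientMap (I.map (algebraMap V W)) (algebraMap V W)
             Ideal.le_comap_map)] := by
  tfae_have 1 → 2 := by
    rintro ⟨⟨_, _⟩, hinj, hloc⟩
    have : Module.IsTorsionFree V W := by
      rw [Module.isTorsionFree_iff_algebraMap_injective]
      exact hinj
    have : Module.Flat V W :=
      Module.Flat.flat_iff_torsion_eq_bot_of_isBezout.mpr
        (Submodule.isTorsionFree_iff_torsion_eq_bot.mp this)
    exact Module.FaithfullyFlat.of_flat_of_isLocalHom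
  tfae_have 2 → 3 := by
    intro _ I
    exact Ideal.quotientMap_injective' (Ideal.comap_map_eq_self_of_faithfullyFlat I).le
  tfae_have 3 → 1 := by
    intro h
    have hcomap (I : Ideal V) (x : V)
        (hx : algebraMap V W x ∈ I.map (algebraMap V W)) : x ∈ I := by
      rw [← Ideal.Quotient.eq_zero_iff_mem]
      apply h I
      rw [map_zero, Ideal.quotientMap_mk, Ideal.Quotient.eq_zero_iff_mem]
      exact hx
    have hdvd (a b : V) (hab : algebraMap V W a ∣ algebraMap V W b) : a ∣ b := by
      rw [← Ideal.mem_span_singleton]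
      apply hcomap
      rwa [Ideal.map_span, Set.image_singleton, Ideal.mem_span_singleton]
    have hinj : Function.Injective (algebraMap V W) := by
      rw [injective_iff_map_eq_zero]
      intro a ha
      exact zero_dvd_iff.mp (hdvd 0 a (by simp [ha]))
    have hdom : IsDomain V := hinj.isDomain (algebraMap V W)
    refine ⟨⟨hdom, ValuationRing.iff_dvd_total.mpr ⟨fun a b ↦ ?_⟩⟩, hinj, ⟨fun a ha ↦ ?_⟩⟩
    · exact (ValuationRing.dvd_total (algebraMap V W a) (algebraMap V W b)).imp
        (hdvd a b) (hdvd b a)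
    · exact isUnit_of_dvd_one (hdvd a 1 (by simpa using ha.dvd))
  tfae_finish
end

section
/- Let L/K be a finite field extension, let O_ω be a valuation ring of L and let O_ν be a valuation ring of K such that O_ω dominates O_ν (equivalently, O_ν = O_ω ∩ K). Then O_ω is essentially of finite type over O_ν if and only if O_ω is essentially of finite presentation over O_ν. -/
/-- An `R`-algebra `S` is *essentially of finite type* over `R` if `S` is a localization of a
finite type `R`-algebra. -/
def Algebra.EssentiallyOfFiniteType (R : Type u) (S : Type v) [CommRing R] [CommRing S]
    [Algebra R S] : Prop :=
  ∃ (C : Type v) (_ : CommRing C) (_ : Algebra R C) (_ : Algebra C S)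
    (_ : IsScalarTower R C S) (M : Submonoid C),
      Algebra.FiniteType R C ∧ IsLocalization M S

/-- An `R`-algebra `S` is *essentially of finite presentation* over `R` if `S` is a
localization of a finitely presented `R`-algebra. -/
def Algebra.EssentiallyOfFinitePresentation (R : Type u) (S : Type v) [CommRing R] [CommRing S]
    [Algebra R S] : Prop :=
  ∃ (C : Type v) (_ : CommRing C) (_ : Algebra R C) (_ : Algebra C S)
    (_ : IsScalarTower R C S) (M : Submonoid C),
      Algebra.FinitePresentation R C ∧ IsLocalization M S

namespace Module

variable {O M N : Type*} [CommRing O] [IsDomain O] [ValuationRing O] [AddCommGroup M] [Module O M]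
  [AddCommGroup N] [Module O N]

/-- The kernel of a linear map from a finite module to a torsion-free module over a valuation
ring is finitely generated. -/
theorem ker_fg_of_isTorsionFree [Module.Finite O M] [IsTorsionFree O N] (f : M →ₗ[O] N) :
    (LinearMap.ker f).FG := by
  have : IsTorsionFree O (LinearMap.range f) := inferInstance
  have : Flat O (LinearMap.range f) := by
    rwa [Flat.flat_iff_torsion_eq_bot_of_isBezout, ← Submodule.isTorsionFree_iff_torsion_eq_bot]
  have : Free O (LinearMap.range f) := free_of_flat_of_isLocalRing
  have : FinitePresentation O (LinearMap.range f) := finitePresentation_of_projective O _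
  rw [← LinearMap.ker_rangeRestrict]
  exact FinitePresentation.fg_ker _ f.surjective_rangeRestrict

end Module

namespace Submodule

variable {O M : Type*} [CommRing O] [IsDomain O] [AddCommGroup M] [Module O M]

theorem isTorsionFree_quotient_of_smul_mem {N : Submodule O M}
    (hN : ∀ a : O, a ≠ 0 → ∀ x : M, a • x ∈ N → x ∈ N) : Module.IsTorsionFree O (M ⧸ N) := by
  refine .of_smul_eq_zero fun a m h => ?_
  obtain ⟨x, rfl⟩ := N.mkQ_surjective m
  rw [or_iff_not_imp_left]
  intro ha
  rw [← map_smul, mkQ_apply, Quotient.mk_eq_zero] at h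
  rw [mkQ_apply, Quotient.mk_eq_zero]
  exact hN a ha x h

theorem inf_fg_of_smul_mem [ValuationRing O] {N H : Submodule O M} (hH : H.FG)
    (hN : ∀ a : O, a ≠ 0 → ∀ x : M, a • x ∈ N → x ∈ N) : (N ⊓ H).FG := by
  have := isTorsionFree_quotient_of_smul_mem hN
  have : Module.Finite O H := Module.Finite.of_fg hH
  have h := (Module.ker_fg_of_isTorsionFree (N.mkQ ∘ₗ H.subtype)).map H.subtype
  rwa [LinearMap.ker_comp, ker_mkQ, map_comap_subtype, inf_comm] at h

end Submodule

namespace MvPolynomial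

variable {O : Type*} [CommRing O] {σ : Type*}

theorem map_homogeneousComponent {S : Type*} [CommRing S] (f : O →+* S) (n : ℕ)
    (p : MvPolynomial σ O) :
    map f (homogeneousComponent n p) = homogeneousComponent n (map f p) := by
  ext d
  simp only [coeff_map, coeff_homogeneousComponent]
  split_ifs <;> simp

/-- Over a valuation ring, the content of a polynomial can be factored out. -/
theorem exists_eq_C_mul_of_map_residue_eq_zero [IsDomain O] [ValuationRing O]
    {p : MvPolynomial σ O} (hp : map (IsLocalRing.residue O) p = 0) :
    ∃ a ∈ IsLocalRing.maximalIdeal O, ∃ q, p = C a * q := by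
  have hfin : (Ideal.span (p.coeffs : Set O)).FG := ⟨_, rfl⟩
  obtain ⟨a, ha⟩ := IsBezout.isPrincipal_of_FG _ hfin
  have hle : Ideal.span (p.coeffs : Set O) ≤ IsLocalRing.maximalIdeal O := by
    rw [Ideal.span_le]
    intro c hc
    obtain ⟨n, -, rfl⟩ := mem_coeffs_iff.mp hc
    have := congrArg (coeff n) hp
    rwa [coeff_map, coeff_zero, IsLocalRing.residue_eq_zero_iff] at this
  refine ⟨a, hle (ha ▸ Ideal.mem_span_singleton_self a), ?_⟩
  change C a ∣ p
  rw [C_dvd_iff_dvd_coeff]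
  intro n
  rw [← Ideal.mem_span_singleton]
  by_cases h : coeff n p = 0
  · simp [h]
  · change _ ∈ Submodule.span O {a}
    rw [← ha]
    exact Ideal.subset_span (coeff_mem_coeffs n h)

theorem IsHomogeneous.of_C_mul [IsDomain O] {a : O} (ha : a ≠ 0) {p : MvPolynomial σ O} {n : ℕ}
    (h : (C a * p).IsHomogeneous n) : p.IsHomogeneous n := by
  intro d hd
  refine h (d := d) ?_
  rw [coeff_C_mul]
  exact mul_ne_zero ha hd

/-- Dehomogenization with respect to the variable `none`. -/
noncomputable def dehomogenize (σ O : Type*) [CommRing O] :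
    MvPolynomial (Option σ) O →ₐ[O] MvPolynomial σ O :=
  aeval fun i => i.elim 1 X

theorem exists_isHomogeneous_dehomogenize_eq (p : MvPolynomial σ O) :
    ∃ (n : ℕ) (q : MvPolynomial (Option σ) O), q.IsHomogeneous n ∧ dehomogenize σ O q = p := by
  refine ⟨p.totalDegree, ∑ d ∈ p.support, rename some (monomial d (coeff d p)) *
    X none ^ (p.totalDegree - d.degree), ?_, ?_⟩
  · refine IsHomogeneous.sum _ _ _ fun d hd => ?_
    have h1 : (rename (some : σ → Option σ) (monomial d (coeff d p))).IsHomogeneous d.degree :=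
      (isHomogeneous_monomial _ rfl).rename_isHomogeneous
    have h2 := h1.mul (isHomogeneous_X_pow (R := O) (none : Option σ) (p.totalDegree - d.degree))
    have h3 : d.degree ≤ p.totalDegree := (Finsupp.degree_apply d).trans_le (le_totalDegree hd)
    rwa [Nat.add_sub_cancel' h3] at h2
  · have h : ∀ q : MvPolynomial σ O, dehomogenize σ O (rename some q) = q := fun q => by
      rw [dehomogenize, aeval_rename]
      exact aeval_X_left_apply q
    conv_rhs => rw [p.as_sum]
    rw [map_sum]
    refine Finset.sum_congr rfl fun d _ => ?_
    rw [map_mul, h, map_pow]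
    simp [dehomogenize]

section

attribute [local instance] MvPolynomial.gradedAlgebra

theorem _root_.Ideal.IsHomogeneous.eq_span_isHomogeneous {I : Ideal (MvPolynomial σ O)}
    (hI : I.IsHomogeneous (homogeneousSubmodule σ O)) :
    I = Ideal.span {p | p ∈ I ∧ ∃ n, p.IsHomogeneous n} := by
  refine le_antisymm (fun p hp => ?_) (Ideal.span_le.mpr fun p hp => hp.1)
  rw [← sum_homogeneousComponent p]
  exact sum_mem fun n _ => Ideal.subset_span
    ⟨homogeneousComponent_mem_of_mem hI hp n, n, homogeneousComponent_isHomogeneous n p⟩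

variable [IsDomain O] [ValuationRing O] [Finite σ]

theorem fg_of_isHomogeneous_of_C_mul_mem {I : Ideal (MvPolynomial σ O)}
    (hI : I.IsHomogeneous (homogeneousSubmodule σ O))
    (hsat : ∀ a : O, a ≠ 0 → ∀ p, C a * p ∈ I → p ∈ I) : I.FG := by
  classical
  set f := map (σ := σ) (IsLocalRing.residue O) with hf
  have hfs : Function.Surjective f := map_surjective _ IsLocalRing.residue_surjective
  set S := {p | p ∈ I ∧ ∃ n, p.IsHomogeneous n}
  have hfg : (Ideal.span (f '' S)).FG := IsNoetherian.noetherian _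
  obtain ⟨t, htS, ht⟩ := (Submodule.fg_span_iff_fg_span_finset_subset _).mp hfg
  obtain ⟨s, hs, rfl⟩ := Finset.subset_set_image_iff.mp htS
  set J := Ideal.span (s : Set (MvPolynomial σ O)) with hJ
  have hJI : J ≤ I := Ideal.span_le.mpr fun p hp => (hs hp).1
  have hJh : J.IsHomogeneous (homogeneousSubmodule σ O) :=
    Ideal.homogeneous_span _ _ fun p hp => (hs hp).2
  have hmap : I.map f = J.map f := by
    rw [hI.eq_span_isHomogeneous, Ideal.map_span, hJ, Ideal.map_span]
    simpa using ht
  refine ⟨s, le_antisymm hJI ?_⟩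
  have key (n : ℕ) : I.restrictScalars O ⊓ homogeneousSubmodule σ O n ≤ J.restrictScalars O := by
    refine Submodule.le_of_le_smul_of_le_jacobson_bot (I := IsLocalRing.maximalIdeal O)
      (Submodule.inf_fg_of_smul_mem (homogeneousSubmodule_fg σ O n) ?_)
      (IsLocalRing.jacobson_eq_maximalIdeal ⊥ bot_ne_top).ge ?_
    · intro a ha p hp
      exact hsat a ha p (by simpa [C_mul'] using hp)
    · rintro p ⟨hpI, hpn⟩
      obtain ⟨g, hgJ, hg⟩ := (Ideal.mem_map_iff_of_surjective f hfs).mp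
        (hmap ▸ Ideal.mem_map_of_mem f hpI)
      have hgn := homogeneousComponent_mem_of_mem hJh hgJ n
      have hpn' : homogeneousComponent n p = p := homogeneousComponent_eq_self hpn
      have h0 : f (p - homogeneousComponent n g) = 0 := by
        rw [map_sub, hf, map_homogeneousComponent, ← hf, hg, hf, ← map_homogeneousComponent,
          hpn', sub_self]
      obtain ⟨a, ham, q, hq⟩ := exists_eq_C_mul_of_map_residue_eq_zero h0
      rw [← add_sub_cancel (homogeneousComponent n g) p]
      refine Submodule.add_mem_sup hgn ?_
      by_cases ha : a = 0
      · rw [hq, ha]; simp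
      · rw [hq, C_mul']
        refine Submodule.smul_mem_smul ham ⟨hsat a ha q ?_, IsHomogeneous.of_C_mul ha ?_⟩
        · rw [← hq]
          exact sub_mem hpI (hJI hgn)
        · rw [← hq]
          exact IsHomogeneous.sub hpn (homogeneousComponent_isHomogeneous n g)
  rw [hI.eq_span_isHomogeneous, Ideal.span_le]
  rintro p ⟨hpI, n, hpn⟩
  exact key n ⟨hpI, hpn⟩

/-- An ideal of a polynomial ring over a valuation ring whose quotient is torsion-free is finitely
generated. -/
theorem fg_of_C_mul_mem {I : Ideal (MvPolynomial σ O)}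
    (hsat : ∀ a : O, a ≠ 0 → ∀ p, C a * p ∈ I → p ∈ I) : I.FG := by
  set φ := dehomogenize σ O
  set H := (I.comap φ).homogeneousCore (homogeneousSubmodule (Option σ) O)
  have hHle : H.toIdeal ≤ I.comap φ := Ideal.toIdeal_homogeneousCore_le _ _
  have hHfg : H.toIdeal.FG := by
    refine fg_of_isHomogeneous_of_C_mul_mem H.isHomogeneous fun a ha p hp => ?_
    rw [mem_iff_homogeneousComponent_mem H.isHomogeneous]
    intro n
    refine Ideal.mem_homogeneousCore_of_homogeneous_of_mem
      ⟨n, homogeneousComponent_isHomogeneous n p⟩ (hsat a ha _ ?_)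
    have h := hHle (homogeneousComponent_mem_of_mem H.isHomogeneous hp n)
    rwa [homogeneousComponent_C_mul, Ideal.mem_comap, map_mul, ← algebraMap_eq,
      AlgHom.commutes, algebraMap_eq] at h
  convert hHfg.map φ.toRingHom
  refine le_antisymm (fun p hp => ?_) (Ideal.map_le_iff_le_comap.mpr hHle)
  obtain ⟨n, q, hq, rfl⟩ := exists_isHomogeneous_dehomogenize_eq p
  exact Ideal.mem_map_of_mem φ.toRingHom
    (Ideal.mem_homogeneousCore_of_homogeneous_of_mem ⟨n, hq⟩ hp)

end

end MvPolynomial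

/-- **Nagata**: a torsion-free algebra of finite type over a valuation ring is of finite
presentation. -/
theorem Algebra.FinitePresentation.of_finiteType_of_isTorsionFree {O A : Type*} [CommRing O]
    [IsDomain O] [ValuationRing O] [CommRing A] [Algebra O A] [Module.IsTorsionFree O A]
    (h : Algebra.FiniteType O A) : Algebra.FinitePresentation O A := by
  obtain ⟨n, f, hf⟩ := Algebra.FiniteType.iff_quotient_mvPolynomial''.mp h
  refine ⟨n, f, hf, MvPolynomial.fg_of_C_mul_mem fun a ha p hp => ?_⟩
  have hp : f (MvPolynomial.C a * p) = 0 := hp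
  rw [MvPolynomial.C_mul', map_smul, smul_eq_zero_iff_right ha] at hp
  exact hp

theorem Algebra.EssentiallyOfFiniteType.essFiniteType {R : Type u} {S : Type v} [CommRing R]
    [CommRing S] [Algebra R S] (h : Algebra.EssentiallyOfFiniteType R S) :
    Algebra.EssFiniteType R S := by
  obtain ⟨C, _, _, _, _, M, hC, hM⟩ := h
  have : Algebra.EssFiniteType C S := .of_isLocalization S M
  exact .comp R C S

theorem Algebra.EssentiallyOfFinitePresentation.of_essFiniteType {R : Type u} {S : Type v}
    [CommRing R] [IsDomain R] [ValuationRing R] [CommRing S] [Algebra R S]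
    [Module.IsTorsionFree R S] [Algebra.EssFiniteType R S] :
    Algebra.EssentiallyOfFinitePresentation R S :=
  ⟨Algebra.EssFiniteType.subalgebra R S, inferInstance, inferInstance, inferInstance,
    inferInstance, Algebra.EssFiniteType.submonoid R S,
    .of_finiteType_of_isTorsionFree inferInstance, inferInstance⟩

/-- Let `L/K` be a finite field extension, `O_ω` a valuation ring of `L`
dominating a valuation ring `O_ν` of `K` (the inclusion `O_ν → O_ω` is given by an algebra
structure compatible with `K → L`, and is a local homomorphism).  Then `O_ω` is essentially of
finite type over `O_ν` if and only if `O_ω` is essentially of finite presentation over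
`O_ν`. -/
theorem essFiniteType_iff_essFinitePresentation_of_valuation_extension
    {K L : Type u} [Field K] [Field L] [Algebra K L] [FiniteDimensional K L]
    (ν : ValuationSubring K) (ω : ValuationSubring L) [Algebra ↥ν ↥ω]
    (hcomp : ∀ x : ↥ν, (algebraMap ↥ν ↥ω x : L) = algebraMap K L (x : K))
    (hloc : IsLocalHom (algebraMap ↥ν ↥ω)) :
    Algebra.EssentiallyOfFiniteType ↥ν ↥ω ↔
      Algebra.EssentiallyOfFinitePresentation ↥ν ↥ω := by
  constructor
  · intro h
    have hinj : Function.Injective (algebraMap ν ω) := fun x y hxy => by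
      refine Subtype.ext ((algebraMap K L).injective ?_)
      rw [← hcomp, ← hcomp, hxy]
    have : FaithfulSMul ν ω := (faithfulSMul_iff_algebraMap_injective ν ω).mpr hinj
    have := h.essFiniteType
    exact .of_essFiniteType
  · rintro ⟨C, _, _, _, _, M, _, hM⟩
    exact ⟨C, inferInstance, inferInstance, inferInstance, inferInstance, M, inferInstance, hM⟩
end

section
/- Let L/K be a finite field extension, let O_ω be a valuation ring of L and let O_ν be a valuation ring of K such that O_ω dominates O_ν, and let A denote the integral closure of O_ν in L. If O_ω is essentially of finite type over O_ν, then there exist an O_ν-subalgebra B of A that is finitely generated as an O_ν-module and free of finite rank as an O_ν-module, with Frac(B) = L, and a maximal ideal q of B such that O_ω equals the localization B_q. -/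
open Polynomial in
theorem exists_polynomial_aeval_eq_zero_of_isAlgebraic {K L : Type*} [Field K] [Field L] [Algebra K L]
    (ν : ValuationSubring K) {x : L} (hx : IsAlgebraic K x) :
    ∃ f : (↥ν)[X], (∃ i, f.coeff i = 1) ∧ (f.map (algebraMap ν K)).aeval x = 0 := by
  obtain ⟨p, hp, hpx⟩ := hx
  obtain ⟨i, hi, hmax⟩ := p.support.exists_max_image (fun i => ν.valuation (p.coeff i))
    (support_nonempty.mpr hp)
  have hi0 : p.coeff i ≠ 0 := mem_support_iff.mp hi
  have hlift : C (p.coeff i)⁻¹ * p ∈ lifts (algebraMap ν K) := by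
    rw [lifts_iff_coeff_lifts]
    intro n
    refine ⟨⟨(C (p.coeff i)⁻¹ * p).coeff n, (ν.valuation_le_one_iff _).mp ?_⟩, rfl⟩
    rw [coeff_C_mul, map_mul, map_inv₀]
    refine inv_mul_le_one_of_le₀ ?_ zero_le
    by_cases hn : n ∈ p.support
    · exact hmax n hn
    · simp [notMem_support_iff.mp hn]
  obtain ⟨f, hf⟩ := (mem_lifts _).mp hlift
  refine ⟨f, ⟨i, ?_⟩, by simp [hf, hpx]⟩
  apply Subtype.val_injective
  have : algebraMap ν K (f.coeff i) = 1 := by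
    rw [← coeff_map, hf, coeff_C_mul, inv_mul_cancel₀ hi0]
  exact this

open Polynomial in
theorem exists_eq_div_of_aeval_eq_zero {R L : Type*} [CommRing R] [Field L] [Algebra R L]
    (ω : ValuationSubring L) (hω : ∀ y ∈ integralClosure R L, y ∈ ω) {x : L} (hx : x ∈ ω)
    (n : ℕ) (f : (integralClosure R L)[X]) (hn : f.natDegree ≤ n) (hfx : f.aeval x = 0)
    (hf : ∃ i, ω.valuation (f.coeff i : L) = 1) :
    ∃ a ∈ integralClosure R L, ∃ b ∈ integralClosure R L,
      ω.valuation b = 1 ∧ x = a / b := by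
  induction n generalizing f with
  | zero =>
    obtain ⟨i, hi⟩ := hf
    rw [eq_C_of_natDegree_le_zero hn] at hfx hi
    have h0 : (f.coeff 0 : L) = 0 := by simpa [aeval_C] using hfx
    rw [coeff_C] at hi
    split_ifs at hi <;> simp [h0] at hi
  | succ n ih =>
    have hint : IsIntegral R ((f.coeff (n + 1) : L) * x) := by
      by_cases hd : f.natDegree = n + 1
      · have := isIntegral_trans (R := R) _ (isIntegral_leadingCoeff_smul f x hfx)
        rwa [leadingCoeff, hd] at this
      · rw [coeff_eq_zero_of_natDegree_lt (by omega)]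
        simpa using isIntegral_zero
    by_cases h1 : ω.valuation (f.coeff (n + 1) : L) = 1
    · refine ⟨_, hint, _, (f.coeff (n + 1)).2, h1, ?_⟩
      rw [mul_div_cancel_left₀]
      rintro h0
      simp [h0] at h1
    have hlt : ω.valuation ((f.coeff (n + 1) : L) * x) < 1 := by
      rw [map_mul]
      exact mul_lt_one_of_lt_of_le
        (lt_of_le_of_ne ((ω.valuation_le_one_iff _).mpr (hω _ (f.coeff (n + 1)).2)) h1)
        ((ω.valuation_le_one_iff _).mpr hx)
    have hdecomp : f.erase (n + 1) + monomial (n + 1) (f.coeff (n + 1)) = f := by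
      rw [add_comm, monomial_add_erase]
    refine ih (f.erase (n + 1) + monomial n ⟨_, hint⟩) ?_ ?_ ?_
    · refine natDegree_add_le_of_degree_le ?_ (natDegree_monomial_le _)
      rw [natDegree_le_iff_coeff_eq_zero]
      intro N hN
      rw [coeff_erase]
      split_ifs with h
      · rfl
      · exact coeff_eq_zero_of_natDegree_lt (by omega)
    · rw [← hdecomp] at hfx
      rw [map_add, aeval_monomial] at hfx ⊢
      rw [← hfx, pow_succ']
      simp only [Subalgebra.algebraMap_def, Algebra.algebraMap_self_apply, mul_assoc]
    · obtain ⟨i, hi⟩ := hf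
      have hin : i ≠ n + 1 := by rintro rfl; exact h1 hi
      refine ⟨i, ?_⟩
      rw [coeff_add, coeff_erase, if_neg hin, coeff_monomial]
      split_ifs with h
      · rw [AddMemClass.coe_add, Valuation.map_add_eq_of_lt_left _ (by simpa [hi] using hlt), hi]
      · simpa using hi

theorem ValuationSubring.free_of_finite_of_isTorsionFree {K : Type*} [Field K]
    (ν : ValuationSubring K) (M : Type*) [AddCommGroup M] [Module ν M] [Module.Finite ν M]
    [Module.IsTorsionFree ν M] : Module.Free ν M := by
  have : Module.Flat ν M :=
    Module.Flat.flat_iff_torsion_eq_bot_of_isBezout.mpr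
      (Submodule.isTorsionFree_iff_torsion_eq_bot.mp inferInstance)
  exact Module.free_of_flat_of_isLocalRing

theorem ValuationSubring.mem_of_isIntegral {L R : Type*} [Field L] (ω : ValuationSubring L)
    [CommRing R] [Algebra R ω] [Algebra R L] [IsScalarTower R ω L] {y : L}
    (hy : IsIntegral R y) : y ∈ ω := by
  obtain ⟨z, rfl⟩ := IsIntegrallyClosed.isIntegral_iff.mp (hy.tower_top (A := ω))
  exact z.2


/-- Let `L/K` be a finite field extension, `O_ω` a valuation ring of `L`
dominating a valuation ring `O_ν` of `K`, and `A = integralClosure O_ν L`.  If `O_ω` is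
essentially of finite type over `O_ν`, then there is an `O_ν`-subalgebra `B ⊆ A`, finitely
generated and free of finite rank as an `O_ν`-module, with `Frac B = L`, and a maximal ideal
`q` of `B`, such that `O_ω` equals the localization `B_q` (realized inside `L` as the set of
fractions `b / c` with `b, c ∈ B`, `c ∉ q`). -/
theorem valuation_ring_is_localization_of_finite_subalgebra
    {K L : Type u} [Field K] [Field L] [Algebra K L] [FiniteDimensional K L]
    (ν : ValuationSubring K) (ω : ValuationSubring L) [Algebra ↥ν ↥ω]
    [Algebra ↥ν L] [IsScalarTower ↥ν K L]
    (hcomp : ∀ x : ↥ν, (algebraMap ↥ν ↥ω x : L) = algebraMap K L (x : K))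
    (hloc : IsLocalHom (algebraMap ↥ν ↥ω))
    (hft : Algebra.EssentiallyOfFiniteType ↥ν ↥ω) :
    ∃ B : Subalgebra ↥ν L, B ≤ integralClosure ↥ν L ∧
      Module.Finite ↥ν ↥B ∧ Module.Free ↥ν ↥B ∧
      (∀ x : L, ∃ b c : ↥B, (c : L) ≠ 0 ∧ x = (b : L) / (c : L)) ∧
      ∃ q : Ideal ↥B, q.IsMaximal ∧
        (↑ω : Set L) = {x : L | ∃ b c : ↥B, c ∉ q ∧ x = (b : L) / (c : L)} := by
  have : IsScalarTower ν ω L := .of_algebraMap_eq fun x => by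
    rw [IsScalarTower.algebraMap_apply ν K L]
    exact (hcomp x).symm
  have hω : ∀ y ∈ integralClosure ν L, y ∈ ω := fun y hy => ω.mem_of_isIntegral hy
  have hdiv : ∀ x ∈ ω, ∃ a ∈ integralClosure ν L, ∃ b ∈ integralClosure ν L,
      ω.valuation b = 1 ∧ x = a / b := by
    intro x hx
    obtain ⟨f, ⟨i, hi⟩, hfx⟩ :=
      exists_polynomial_aeval_eq_zero_of_isAlgebraic ν (Algebra.IsAlgebraic.isAlgebraic (R := K) x)
    refine exists_eq_div_of_aeval_eq_zero ω hω hx _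
      (f.map (algebraMap ν (integralClosure ν L))) le_rfl ?_ ⟨i, ?_⟩
    · rw [Polynomial.aeval_map_algebraMap] at hfx ⊢
      exact hfx
    · simp [hi]
  obtain ⟨C, _, _, _, _, M, ⟨⟨s, hs⟩⟩, hM⟩ := hft
  choose! num hnum den hden hden1 hx using hdiv
  let φ : C →+* L := (algebraMap ω L).comp (algebraMap C ω)
  have hφ : ∀ c, φ c ∈ ω := fun c => (algebraMap C ω c).2
  let t : Set L := (num ∘ φ) '' s ∪ (den ∘ φ) '' s
  have ht : ∀ y ∈ t, IsIntegral ν y := by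
    rintro y (⟨c, -, rfl⟩ | ⟨c, -, rfl⟩)
    · exact hnum _ (hφ c)
    · exact hden _ (hφ c)
  let B : Subalgebra ν L := Algebra.adjoin ν t
  have hBA : B ≤ integralClosure ν L := Algebra.adjoin_le ht
  have hfin : Module.Finite ν B :=
    Module.Finite.iff_fg.mpr <| fg_adjoin_of_finite
      ((s.finite_toSet.image _).union (s.finite_toSet.image _)) ht
  let ι : B →+* ω := (algebraMap B L).codRestrict ω.toSubring fun b => hω _ (hBA b.2)
  let q : Ideal B := (IsLocalRing.maximalIdeal ω).comap ι
  have hq : ∀ c : B, c ∉ q ↔ ω.valuation (c : L) = 1 := fun c => by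
    change ι c ∉ IsLocalRing.maximalIdeal ω ↔ _
    rw [ω.valuation_lt_one_iff, not_lt]
    exact (((ω.valuation_le_one_iff _).mpr (ι c).2).ge_iff_eq).trans Iff.rfl
  have hqmax : q.IsMaximal := by
    have : q.IsPrime := Ideal.comap_isPrime _ _
    refine Ideal.isMaximal_of_isIntegral_of_isMaximal_comap (R := ν) q ?_
    have hι : ι.comp (algebraMap ν B) = algebraMap ν ω := RingHom.ext fun r =>
      Subtype.ext (IsScalarTower.algebraMap_apply ν ω L r)
    rw [Ideal.comap_comap, hι, IsLocalRing.maximalIdeal_comap]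
    infer_instance
  have hC : ∀ c : C, ∃ a b : B, ω.valuation (b : L) = 1 ∧ φ c = a / b := by
    have hne : ∀ {b : L}, ω.valuation b = 1 → b ≠ 0 := by
      rintro b hb rfl
      simp at hb
    intro c
    have hc : c ∈ Algebra.adjoin ν (s : Set C) := hs ▸ Algebra.mem_top
    induction hc using Algebra.adjoin_induction with
    | mem c hc =>
      exact ⟨⟨_, Algebra.subset_adjoin (.inl ⟨c, hc, rfl⟩)⟩,
        ⟨_, Algebra.subset_adjoin (.inr ⟨c, hc, rfl⟩)⟩, hden1 _ (hφ c), hx _ (hφ c)⟩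
    | algebraMap r =>
      refine ⟨algebraMap ν B r, 1, by simp, ?_⟩
      change algebraMap ω L (algebraMap C ω (algebraMap ν C r)) = algebraMap ν L r / 1
      rw [← IsScalarTower.algebraMap_apply ν C ω, ← IsScalarTower.algebraMap_apply ν ω L, div_one]
    | add x y _ _ hx hy =>
      obtain ⟨a, b, hb, hab⟩ := hx
      obtain ⟨c, d, hd, hcd⟩ := hy
      refine ⟨a * d + b * c, b * d, by simp [hb, hd], ?_⟩
      rw [map_add, hab, hcd, div_add_div _ _ (hne hb) (hne hd)]
      rfl
    | mul x y _ _ hx hy =>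
      obtain ⟨a, b, hb, hab⟩ := hx
      obtain ⟨c, d, hd, hcd⟩ := hy
      refine ⟨a * c, b * d, by simp [hb, hd], ?_⟩
      rw [map_mul, hab, hcd, div_mul_div_comm]
      rfl
  have hωB : (ω : Set L) = {x : L | ∃ b c : B, c ∉ q ∧ x = (b : L) / (c : L)} := by
    ext x
    constructor
    · intro hxω
      obtain ⟨⟨c, m⟩, hcm⟩ := IsLocalization.surj M (⟨x, hxω⟩ : ω)
      have hcm' : x * φ m = φ c := congrArg Subtype.val hcm
      have hm : ω.valuation (φ m) = 1 :=
        (ω.valuation_eq_one_iff _).mp (IsLocalization.map_units ω m)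
      obtain ⟨a, b, hb, hab⟩ := hC c
      obtain ⟨a', b', hb', hab'⟩ := hC m
      have ha' : ω.valuation (a' : L) = 1 := by
        rw [hab', map_div₀, hb', div_one] at hm
        exact hm
      refine ⟨a * b', b * a', (hq _).mpr (by simp [hb, ha']), ?_⟩
      have h0 : φ m ≠ 0 := by
        intro h
        simp [h] at hm
      rw [eq_div_of_mul_eq h0 hcm', hab, hab', div_div_div_eq]
      rfl
    · rintro ⟨b, c, hc, rfl⟩
      refine (ω.valuation_le_one_iff _).mp ?_
      rw [map_div₀, (hq c).mp hc, div_one]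
      exact (ω.valuation_le_one_iff _).mpr (hω _ (hBA b.2))
  have hqne : ∀ c : B, c ∉ q → (c : L) ≠ 0 := fun c hc h =>
    hc ((Subtype.ext h : c = 0) ▸ q.zero_mem)
  refine ⟨B, hBA, hfin, ?_, fun x => ?_, q, hqmax, hωB⟩
  · have : Module.IsTorsionFree ν L := .trans_faithfulSMul ν K L
    exact ν.free_of_finite_of_isTorsionFree B
  · rcases ω.mem_or_inv_mem x with h | h
    · obtain ⟨b, c, hc, hxbc⟩ := hωB.subset h
      exact ⟨b, c, hqne c hc, hxbc⟩
    · obtain ⟨b, c, hc, hxbc⟩ := hωB.subset h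
      by_cases hb : (b : L) = 0
      · refine ⟨0, 1, by simp, ?_⟩
        rw [hb, zero_div, inv_eq_zero] at hxbc
        simp [hxbc]
      · exact ⟨c, b, hb, by rw [← inv_inv x, hxbc, inv_div]⟩
end

section
/- Let L/K be a finite field extension, let O_ω be a valuation ring of L and let O_ν be a valuation ring of K such that O_ω dominates O_ν. If O_ω is essentially of finite type over O_ν, then there exist an O_ν-algebra B′ that is finitely generated as an O_ν-module and a maximal ideal q of B′ such that O_ω is isomorphic as an O_ν-algebra to the localization B′_q. -/
theorem RingHom.isIntegralElem_of_forall_mem_valuationSubring {R L : Type*} [CommRing R] [Field L]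
    (φ : R →+* L) {x : L} (h : ∀ V : ValuationSubring L, (∀ r, φ r ∈ V) → x ∈ V) :
    φ.IsIntegralElem x := by
  have hx : x ∈ ⨅ V : {V : ValuationSubring L // (φ.range : Set L) ⊆ V.toSubring},
      V.1.toSubring := by
    rw [Subring.mem_iInf]
    exact fun V ↦ h V.1 fun r ↦ V.2 ⟨r, rfl⟩
  rw [iInf_valuationSubring_superset, Subring.closure_eq] at hx
  have hx : _root_.IsIntegral φ.range x := hx
  let _ : Algebra R L := φ.toAlgebra
  let _ : Algebra R φ.range := φ.rangeRestrict.toAlgebra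
  have : IsScalarTower R φ.range L := .of_algebraMap_eq fun _ ↦ rfl
  have : Algebra.IsIntegral R φ.range :=
    ⟨fun y ↦ by
      obtain ⟨r, rfl⟩ := φ.rangeRestrict_surjective y
      exact isIntegral_algebraMap (R := R) (A := φ.range)⟩
  exact isIntegral_trans (R := R) x hx

open Polynomial in
/-- After scaling, a nonzero polynomial over a valued field has coefficients of valuation at most
one, some coefficient equal to one, and all later coefficients of valuation less than one. -/
theorem Polynomial.exists_coeff_eq_one_and_valuation_lt_one {K : Type*} [Field K]
    (ν : ValuationSubring K) {f : K[X]} (hf : f ≠ 0) :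
    ∃ (c : K) (k : ℕ), (C c * f).coeff k = 1 ∧ (∀ i, (C c * f).coeff i ∈ ν) ∧
      ∀ i, k < i → ν.valuation ((C c * f).coeff i) < 1 := by
  obtain ⟨m, hm, hmax⟩ := f.support.exists_max_image (fun i ↦ ν.valuation (f.coeff i))
    (Polynomial.nonempty_support_iff.mpr hf)
  have hmax' : ∀ i, ν.valuation (f.coeff i) ≤ ν.valuation (f.coeff m) := fun i ↦ by
    by_cases hi : i ∈ f.support
    · exact hmax i hi
    · simp [Polynomial.notMem_support_iff.mp hi]
  let T := f.support.filter fun i ↦ ν.valuation (f.coeff i) = ν.valuation (f.coeff m)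
  obtain ⟨k, hk, hkmax⟩ := T.exists_max_image id ⟨m, by simp [T, Polynomial.mem_support_iff.mp hm]⟩
  obtain ⟨hk0, hkm⟩ := Finset.mem_filter.mp hk
  rw [Polynomial.mem_support_iff] at hk0
  have hpos : 0 < ν.valuation (f.coeff k) := zero_lt_iff.mpr ((Valuation.ne_zero_iff _).mpr hk0)
  refine ⟨(f.coeff k)⁻¹, k, by simp [hk0], fun i ↦ ?_, fun i hi ↦ ?_⟩
  · rw [← ν.valuation_le_one_iff, coeff_C_mul, map_mul, map_inv₀, mul_comm, ← div_eq_mul_inv,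
      div_le_one₀ hpos, hkm]
    exact hmax' i
  · rw [coeff_C_mul, map_mul, map_inv₀, mul_comm, ← div_eq_mul_inv, div_lt_one₀ hpos, hkm]
    refine (hmax' i).lt_of_ne fun h ↦ hi.not_ge (hkmax i ?_)
    refine Finset.mem_filter.mpr ⟨Polynomial.mem_support_iff.mpr fun h0 ↦ ?_, h⟩
    rw [h0, map_zero, ← hkm] at h
    exact hpos.ne h

open Polynomial in
/-- An element of a valuation ring `ω` dominating `ν` that is algebraic over the fraction field of
`ν` is a quotient of elements integral over `ν` whose denominator is a unit of `ω`. -/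
theorem ValuationSubring.exists_isIntegralElem_mul_of_isAlgebraic {K L : Type*} [Field K] [Field L]
    [Algebra K L] (ν : ValuationSubring K) (ω : ValuationSubring L)
    (hlt : ∀ y, ν.valuation y < 1 → ω.valuation (algebraMap K L y) < 1)
    {x : L} (hx : x ∈ ω) (hxalg : IsAlgebraic K x) :
    ∃ s : L, ω.valuation s = 1 ∧ ((algebraMap K L).comp ν.subtype).IsIntegralElem s ∧
      ((algebraMap K L).comp ν.subtype).IsIntegralElem (s * x) := by
  by_cases hx0 : x = 0
  · refine ⟨1, map_one _, RingHom.isIntegralElem_one _, ?_⟩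
    simpa [hx0] using RingHom.isIntegralElem_zero _
  obtain ⟨f, hf0, hfx⟩ := hxalg
  obtain ⟨c, k, hgk, hgmem, hglt⟩ := f.exists_coeff_eq_one_and_valuation_lt_one ν hf0
  set g := C c * f with hg
  have hgx : aeval x g = 0 := by simp [hg, hfx]
  have hkd : k ≤ g.natDegree := le_natDegree_of_ne_zero (by simp [hgk])
  obtain ⟨N, hN⟩ := Nat.exists_eq_add_of_le hkd
  let b : ℕ → L := fun i ↦ algebraMap K L (g.coeff i)
  let s : L := ∑ j ∈ Finset.range (N + 1), b (k + j) * x ^ j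
  let r : L := ∑ i ∈ Finset.range k, b i * x ^ i
  have hrs : r + s * x ^ k = 0 := by
    rw [aeval_eq_sum_range, hN, add_assoc, Finset.sum_range_add] at hgx
    rw [← hgx, Finset.sum_mul]
    simp only [Algebra.smul_def, r, b, pow_add, mul_assoc, mul_comm (x ^ k)]
  have hs1 : ω.valuation s = 1 := by
    have hs : s = 1 + ∑ j ∈ Finset.range N, b (k + (j + 1)) * x ^ (j + 1) := by
      simp [s, Finset.sum_range_succ', b, hgk, add_comm]
    rw [hs]
    refine Valuation.map_one_add_of_lt _ (Valuation.map_sum_lt _ one_ne_zero fun j _ ↦ ?_)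
    rw [map_mul]
    exact mul_lt_one_of_lt_of_le (hlt _ (hglt _ (by lia)))
      ((ω.valuation_le_one_iff _).mpr (pow_mem hx _))
  obtain _ | k := k
  · have : s = 0 := by simpa [r] using hrs
    simp [this] at hs1
  have hsx : s * x = -∑ i ∈ Finset.range (k + 1), b i * x⁻¹ ^ (k - i) := by
    have hxk : x ^ k ≠ 0 := pow_ne_zero _ hx0
    refine mul_right_cancel₀ hxk ?_
    rw [neg_mul, mul_assoc, ← pow_succ', eq_neg_of_add_eq_zero_right hrs, Finset.sum_mul]
    congr 1
    refine Finset.sum_congr rfl fun i hi ↦ ?_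
    obtain ⟨l, rfl⟩ := Nat.exists_eq_add_of_le (Nat.le_of_lt_succ (Finset.mem_range.mp hi))
    rw [Nat.add_sub_cancel_left, pow_add, inv_pow]
    field_simp
  have key : ∀ V : ValuationSubring L, (∀ a, (algebraMap K L).comp ν.subtype a ∈ V) →
      s ∈ V ∧ s * x ∈ V := fun V hV ↦ by
    have hb : ∀ i, b i ∈ V := fun i ↦ hV ⟨_, hgmem i⟩
    rcases V.mem_or_inv_mem x with h | h
    · have hsV : s ∈ V := sum_mem fun j _ ↦ MulMemClass.mul_mem (hb _) (pow_mem h _)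
      exact ⟨hsV, MulMemClass.mul_mem hsV h⟩
    · have hsxV : s * x ∈ V :=
        hsx ▸ NegMemClass.neg_mem (sum_mem fun j _ ↦ MulMemClass.mul_mem (hb _) (pow_mem h _))
      exact ⟨by simpa [mul_assoc, hx0] using MulMemClass.mul_mem hsxV h, hsxV⟩
  exact ⟨s, hs1, RingHom.isIntegralElem_of_forall_mem_valuationSubring _ fun V hV ↦ (key V hV).1,
    RingHom.isIntegralElem_of_forall_mem_valuationSubring _ fun V hV ↦ (key V hV).2⟩

/-- Let `W` be a local ring that is a localization of a finite type `R`-algebra. If each element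
of `W` becomes integral over `R` after multiplication by an integral unit, then `W` is the
localization of a module-finite subalgebra at the contraction of its maximal ideal. -/
theorem Algebra.EssentiallyOfFiniteType.exists_finite_subalgebra_isLocalization_atPrime
    {R W : Type*} [CommRing R] [CommRing W] [IsLocalRing W] [Algebra R W]
    (h : Algebra.EssentiallyOfFiniteType R W)
    (hW : ∀ x : W, ∃ s : W, IsUnit s ∧ IsIntegral R s ∧ IsIntegral R (s * x)) :
    ∃ B : Subalgebra R W, Module.Finite R B ∧
      IsLocalization.AtPrime W ((IsLocalRing.maximalIdeal W).comap (algebraMap B W)) := by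
  obtain ⟨C, _, _, _, _, M, ⟨⟨t, ht⟩⟩, hM⟩ := h
  choose s hsu hsi hsxi using hW
  let f := IsScalarTower.toAlgHom R C W
  let T : Set W := f '' t
  let S : Set W := s '' T ∪ (fun x ↦ s x * x) '' T
  have hT : T.Finite := t.finite_toSet.image _
  let B := Algebra.adjoin R S
  have hB : Module.Finite R B := by
    refine Algebra.finite_adjoin_of_finite_of_isIntegral ((hT.image _).union (hT.image _)) ?_
    rintro _ (⟨x, _, rfl⟩ | ⟨x, _, rfl⟩)
    exacts [hsi x, hsxi x]
  have frac : ∀ y ∈ Algebra.adjoin R T, ∃ u ∈ B, IsUnit u ∧ u * y ∈ B := by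
    intro y hy
    induction hy using Algebra.adjoin_induction with
    | mem x hx =>
      exact ⟨s x, Algebra.subset_adjoin (.inl ⟨x, hx, rfl⟩), hsu x,
        Algebra.subset_adjoin (.inr ⟨x, hx, rfl⟩)⟩
    | algebraMap r => exact ⟨1, one_mem _, isUnit_one, by simp⟩
    | add x y _ _ hx hy =>
      obtain ⟨u, hu, hu', hux⟩ := hx
      obtain ⟨v, hv, hv', hvy⟩ := hy
      refine ⟨u * v, mul_mem hu hv, hu'.mul hv', ?_⟩
      convert add_mem (mul_mem hv hux) (mul_mem hu hvy) using 1
      ring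
    | mul x y _ _ hx hy =>
      obtain ⟨u, hu, hu', hux⟩ := hx
      obtain ⟨v, hv, hv', hvy⟩ := hy
      refine ⟨u * v, mul_mem hu hv, hu'.mul hv', ?_⟩
      convert mul_mem hux hvy using 1
      ring
  have fracC : ∀ c : C, ∃ u ∈ B, IsUnit u ∧ u * algebraMap C W c ∈ B := fun c ↦ by
    refine frac _ ?_
    rw [← f.map_adjoin, ht]
    exact ⟨c, trivial, rfl⟩
  have hmem : ∀ y : B, y ∈ ((IsLocalRing.maximalIdeal W).comap (algebraMap B W)).primeCompl ↔
      IsUnit (y : W) := fun y ↦ IsLocalRing.notMem_maximalIdeal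
  refine ⟨B, hB, ⟨fun y ↦ (hmem _).mp y.2, fun z ↦ ?_, fun {x y} hxy ↦ ⟨1, ?_⟩⟩⟩
  · obtain ⟨⟨c, m⟩, hz⟩ := IsLocalization.surj M z
    obtain ⟨u, hu, hu', huc⟩ := fracC c
    obtain ⟨v, hv, hv', hvm⟩ := fracC m
    have hmu : IsUnit (algebraMap C W m) := IsLocalization.map_units W m
    refine ⟨(⟨v * (u * algebraMap C W c), mul_mem hv huc⟩,
      ⟨⟨u * (v * algebraMap C W m), mul_mem hu hvm⟩, (hmem _).mpr (hu'.mul (hv'.mul hmu))⟩), ?_⟩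
    change z * (u * (v * algebraMap C W m)) = v * (u * algebraMap C W c)
    rw [← hz]
    ring
  · rw [Subtype.ext hxy]

/-- Let `L/K` be a finite field extension, `O_ω` a valuation ring of `L`
dominating a valuation ring `O_ν` of `K`.  If `O_ω` is essentially of finite type over `O_ν`,
then there exist an `O_ν`-algebra `B'` which is finitely generated as an `O_ν`-module and a
maximal ideal `q` of `B'` such that `O_ω` is isomorphic, as an `O_ν`-algebra, to the
localization `B'_q` (the isomorphism being a ring isomorphism compatible with the maps from
`O_ν`). -/
theorem valuation_ring_is_localization_of_module_finite_algebra
    {K L : Type u} [Field K] [Field L] [Algebra K L] [FiniteDimensional K L]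
    (ν : ValuationSubring K) (ω : ValuationSubring L) [Algebra ↥ν ↥ω]
    (hcomp : ∀ x : ↥ν, (algebraMap ↥ν ↥ω x : L) = algebraMap K L (x : K))
    (hloc : IsLocalHom (algebraMap ↥ν ↥ω))
    (hft : Algebra.EssentiallyOfFiniteType ↥ν ↥ω) :
    ∃ (B' : Type u) (_ : CommRing B') (_ : Algebra ↥ν B'),
      Module.Finite ↥ν B' ∧
      ∃ (q : Ideal B') (hq : q.IsMaximal),
        ∃ e : Localization q.primeCompl ≃+* ↥ω,
          ∀ x : ↥ν,
            e (algebraMap B' (Localization q.primeCompl) (algebraMap ↥ν B' x)) =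
              algebraMap ↥ν ↥ω x := by
  have hlt : ∀ y, ν.valuation y < 1 → ω.valuation (algebraMap K L y) < 1 := fun y hy ↦ by
    have hyν : y ∈ ν := (ν.valuation_le_one_iff y).mp hy.le
    rw [← hcomp ⟨y, hyν⟩, ← ω.valuation_lt_one_iff]
    exact fun hu ↦ (ν.valuation_lt_one_iff ⟨y, hyν⟩).mpr hy (hloc.map_nonunit _ hu)
  have hφ : (algebraMap K L).comp ν.subtype = ω.subtype.comp (algebraMap ν ω) :=
    RingHom.ext fun x ↦ (hcomp x).symm
  have hint : ∀ x : ω, ((algebraMap K L).comp ν.subtype).IsIntegralElem (x : L) →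
      IsIntegral ν x := by
    rintro x ⟨p, hp, hpx⟩
    refine ⟨p, hp, Subtype.val_injective ?_⟩
    rw [hφ, ← ω.subtype_apply, ← Polynomial.hom_eval₂] at hpx
    exact hpx
  obtain ⟨B, hB, hBloc⟩ := hft.exists_finite_subalgebra_isLocalization_atPrime fun x ↦ by
    obtain ⟨s, hs1, hs, hsx⟩ := ν.exists_isIntegralElem_mul_of_isAlgebraic ω hlt x.2
      (Algebra.IsAlgebraic.isAlgebraic (R := K) (x : L))
    let s' : ω := ⟨s, (ω.valuation_le_one_iff s).mp hs1.le⟩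
    exact ⟨s', (ω.valuation_eq_one_iff s').mpr hs1, hint s' hs, hint (s' * x) hsx⟩
  let q := (IsLocalRing.maximalIdeal ω).comap (algebraMap B ω)
  have hq : q.IsMaximal := by
    refine Ideal.isMaximal_of_isIntegral_of_isMaximal_comap (R := ν) q ?_
    have : q.comap (algebraMap ν B) = IsLocalRing.maximalIdeal ν := by
      rw [Ideal.comap_comap, ← IsScalarTower.algebraMap_eq]
      exact ((IsLocalRing.local_hom_TFAE (algebraMap ν ω)).out 0 4).mp hloc
    rw [this]
    infer_instance
  exact ⟨B, inferInstance, inferInstance, hB, q, hq,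
    (IsLocalization.algEquiv q.primeCompl (Localization q.primeCompl) ω).toRingEquiv,
    fun x ↦ AlgEquiv.commutes _ _⟩
end

section
/- Let L/K be an algebraic field extension, let (O_ω, m_ω) be a valuation ring of L and let (O_ν, m_ν) be a valuation ring of K such that O_ω dominates O_ν. Then m_ω is the unique prime ideal P of O_ω with P ∩ O_ν = m_ν. -/
/-- An algebraic element over the fraction field of a valuation ring satisfies a polynomial
relation with coefficients in the valuation ring, at least one of which is a unit. -/
theorem ValuationSubring.exists_isUnit_coeff_sum_eq_zero {K L : Type*} [Field K] [Field L]
    [Algebra K L] (ν : ValuationSubring K) {x : L} (hx : IsAlgebraic K x) :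
    ∃ (N : ℕ) (b : ℕ → ν), (∃ i < N, IsUnit (b i)) ∧
      ∑ i ∈ Finset.range N, algebraMap K L (b i) * x ^ i = 0 := by
  obtain ⟨p, hp, hpx⟩ := hx
  obtain ⟨j, hj, hmax⟩ := Finset.exists_max_image p.support
    (fun i => ν.valuation (p.coeff i)) (Polynomial.support_nonempty.mpr hp)
  have hc : p.coeff j ≠ 0 := Polynomial.mem_support_iff.mp hj
  have hmem : ∀ i, p.coeff i / p.coeff j ∈ ν := by
    intro i
    by_cases hi : i ∈ p.support
    · rw [← ValuationSubring.valuation_le_one_iff, map_div₀]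
      exact div_le_one_of_le₀ (hmax i hi) zero_le
    · rw [Polynomial.notMem_support_iff.mp hi, zero_div]
      exact ν.zero_mem
  refine ⟨p.natDegree + 1, fun i => ⟨p.coeff i / p.coeff j, hmem i⟩,
    ⟨j, Nat.lt_succ_of_le (Polynomial.le_natDegree_of_mem_supp j hj), ?_⟩, ?_⟩
  · convert isUnit_one (M := ν)
    exact Subtype.ext (div_self hc)
  · rw [Polynomial.aeval_eq_sum_range] at hpx
    calc _ = algebraMap K L (p.coeff j)⁻¹ *
          ∑ i ∈ Finset.range (p.natDegree + 1), p.coeff i • x ^ i := by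
          rw [Finset.mul_sum]
          refine Finset.sum_congr rfl fun i _ => ?_
          dsimp only
          rw [Algebra.smul_def, div_eq_mul_inv, map_mul]
          ring
      _ = 0 := by rw [hpx, mul_zero]

/-- If `x` in the maximal ideal of a local ring `B` satisfies a polynomial relation over a local
ring `A` with some unit coefficient, then `x` lies in every prime of `B` containing the image of
the maximal ideal of `A`. -/
theorem IsLocalRing.mem_of_sum_eq_zero_of_isUnit_coeff {A B : Type*} [CommRing A] [IsLocalRing A]
    [CommRing B] [IsLocalRing B] (f : A →+* B) {P : Ideal B} (hP : P.IsPrime)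
    (hle : IsLocalRing.maximalIdeal A ≤ P.comap f) {x : B}
    (hx : x ∈ IsLocalRing.maximalIdeal B) {N : ℕ} {b : ℕ → A} (hb : ∃ i < N, IsUnit (b i))
    (hsum : ∑ i ∈ Finset.range N, f (b i) * x ^ i = 0) : x ∈ P := by
  classical
  obtain ⟨hlt, hu⟩ := Nat.find_spec hb
  have hmin : ∀ i < Nat.find hb, f (b i) ∈ P := fun i hi =>
    hle ((IsLocalRing.mem_maximalIdeal _).mpr fun h => Nat.find_min hb hi ⟨hi.trans hlt, h⟩)
  generalize Nat.find hb = n at hlt hu hmin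
  obtain ⟨k, rfl⟩ := Nat.exists_eq_add_of_le (Nat.succ_le_of_lt hlt)
  rw [Finset.sum_range_add, Finset.sum_range_succ] at hsum
  have hlow : ∑ i ∈ Finset.range n, f (b i) * x ^ i ∈ P :=
    P.sum_mem fun i hi => P.mul_mem_right _ (hmin i (Finset.mem_range.mp hi))
  set s := ∑ i ∈ Finset.range k, f (b (n.succ + i)) * x ^ i with hs
  have htail : ∑ i ∈ Finset.range k, f (b (n.succ + i)) * x ^ (n.succ + i) =
      x ^ n * (x * s) := by
    rw [hs, Finset.mul_sum, Finset.mul_sum]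
    refine Finset.sum_congr rfl fun i _ => ?_
    rw [Nat.succ_eq_add_one]
    ring
  have hunit : IsUnit (f (b n) + x * s) := by
    by_contra h
    refine (IsLocalRing.mem_maximalIdeal _).mp ?_ (hu.map f)
    exact (Ideal.add_mem_iff_left _ (Ideal.mul_mem_right s _ hx)).mp
      ((IsLocalRing.mem_maximalIdeal _).mpr h)
  have hprod : (f (b n) + x * s) * x ^ n ∈ P := by
    have : (f (b n) + x * s) * x ^ n = -∑ i ∈ Finset.range n, f (b i) * x ^ i := by
      rw [htail] at hsum
      linear_combination hsum
    rw [this]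
    exact P.neg_mem hlow
  exact hP.mem_of_pow_mem n ((Ideal.unit_mul_mem_iff_mem P hunit).mp hprod)

/-- Let `L/K` be an algebraic field extension, `O_ω` a valuation ring of `L`
dominating a valuation ring `O_ν` of `K` (the inclusion `O_ν → O_ω` given by an algebra
structure compatible with `K → L` which is a local homomorphism).  Then the maximal ideal
`m_ω` of `O_ω` is the unique prime ideal `P` of `O_ω` with `P ∩ O_ν = m_ν`. -/
theorem maximalIdeal_unique_prime_lying_over
    {K L : Type u} [Field K] [Field L] [Algebra K L] (halg : Algebra.IsAlgebraic K L)
    (ν : ValuationSubring K) (ω : ValuationSubring L) [Algebra ↥ν ↥ω]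
    (hcomp : ∀ x : ↥ν, (algebraMap ↥ν ↥ω x : L) = algebraMap K L (x : K))
    (hloc : IsLocalHom (algebraMap ↥ν ↥ω)) :
    (IsLocalRing.maximalIdeal ↥ω).comap (algebraMap ↥ν ↥ω) =
        IsLocalRing.maximalIdeal ↥ν ∧
      ∀ P : Ideal ↥ω, P.IsPrime →
        P.comap (algebraMap ↥ν ↥ω) = IsLocalRing.maximalIdeal ↥ν →
        P = IsLocalRing.maximalIdeal ↥ω := by
  refine ⟨((IsLocalRing.local_hom_TFAE _).out 0 4).mp hloc, fun P hP hcomap =>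
    le_antisymm (IsLocalRing.le_maximalIdeal hP.ne_top) fun x hx => ?_⟩
  obtain ⟨N, b, hb, hsum⟩ :=
    ν.exists_isUnit_coeff_sum_eq_zero (halg.isAlgebraic (x : L))
  refine IsLocalRing.mem_of_sum_eq_zero_of_isUnit_coeff (algebraMap ν ω) hP hcomap.ge hx hb ?_
  apply ω.subtype_injective
  simpa [hcomp] using hsum
end

section
/- Let L/K be a finite field extension, let ω be a valuation on L with value group Γ_ω and let ν be the restriction of ω to K with value group Γ_ν ⊆ Γ_ω, and let O_ω, O_ν denote the respective valuation rings. If O_ω is essentially of finite type over O_ν, then the cardinality of the set {x ∈ Γ_ω : x ≥ 0 and x < y for all y ∈ Γ_ν with y > 0} equals the index [Γ_ω : Γ_ν]. -/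
variable {K L Γ₀ : Type u} [Field K] [Field L] [Algebra K L]
  [LinearOrderedCommGroupWithZero Γ₀]

/-- The inclusion `O_ν → O_ω` of the valuation ring of the restriction `ν = ω|_K` into the
valuation ring of `ω`. -/
noncomputable def Valuation.extensionInclusion (ω : Valuation L Γ₀) :
    ↥((ω.comap (algebraMap K L)).valuationSubring) →+* ↥(ω.valuationSubring) :=
  RingHom.codRestrict
    ((algebraMap K L).comp ((ω.comap (algebraMap K L)).valuationSubring.subtype))
    ω.valuationSubring.toSubring
    (fun x => x.2)

noncomputable instance (ω : Valuation L Γ₀) :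
    Algebra ↥((ω.comap (algebraMap K L)).valuationSubring) ↥(ω.valuationSubring) :=
  (Valuation.extensionInclusion ω).toAlgebra

open Polynomial

/-- If no element of `s` has the same value as `y`, then the polynomial `∏ r ∈ s, (X - r)`, after
substituting `y * X` for `X`, is a monomial `u * X ^ j` up to terms of smaller value than `u`. -/
theorem Valuation.exists_dominant_coeff {N Γ : Type*} [Field N] [LinearOrderedCommGroupWithZero Γ]
    (v : Valuation N Γ) {y : N} (hy : y ≠ 0) (s : Multiset N) (hs : ∀ r ∈ s, v r ≠ v y) :
    ∃ u : N, u ≠ 0 ∧ ∃ j : ℕ, ∀ i : ℕ,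
      v ((s.map fun r => X - C r).prod.coeff i * y ^ i - if i = j then u else 0) < v u := by
  induction s using Multiset.induction_on with
  | empty =>
    refine ⟨1, one_ne_zero, 0, fun i => ?_⟩
    by_cases hi : i = 0
    · simp [hi]
    · simp [hi, coeff_one]
  | cons r s ih =>
    obtain ⟨u, hu, j, H⟩ := ih fun r hr => hs r (Multiset.mem_cons_of_mem hr)
    have hu' : 0 < v u := (v.pos_iff).2 hu
    have hy' : 0 < v y := (v.pos_iff).2 hy
    set P := (s.map fun r => X - C r).prod with hP
    have hF (i : ℕ) : v (P.coeff i * y ^ i) ≤ v u := by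
      have h := v.map_add_le (H i).le (show v (if i = j then u else 0) ≤ v u by
        split_ifs <;> simp)
      simpa using h
    have hE (i : ℕ) (E : N) :
        (X * P - C r * P).coeff i * y ^ i - E =
          ((X * P).coeff i * y ^ i - E) - r * (P.coeff i * y ^ i) := by
      rw [coeff_sub, coeff_C_mul]; ring
    have hE' (i : ℕ) : v ((X * P).coeff i * y ^ i - if i = j + 1 then y * u else 0) < v y * v u := by
      rcases i with _ | i
      · simpa using mul_pos hy' hu'
      · have : (X * P).coeff (i + 1) * y ^ (i + 1) - (if i + 1 = j + 1 then y * u else 0) =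
            y * (P.coeff i * y ^ i - if i = j then u else 0) := by
          rw [coeff_X_mul]
          by_cases h : i = j <;> simp [h] <;> ring
        rw [this, map_mul]
        exact mul_lt_mul_of_pos_left (H i) hy'
    rcases lt_or_gt_of_ne (hs r (Multiset.mem_cons_self r s)) with hr | hr
    · refine ⟨y * u, mul_ne_zero hy hu, j + 1, fun i => ?_⟩
      rw [Multiset.map_cons, Multiset.prod_cons, ← hP, sub_mul, hE, map_mul]
      refine v.map_sub_lt (hE' i) ?_
      rw [map_mul]
      exact (mul_le_mul_right (hF i) _).trans_lt (mul_lt_mul_of_pos_right hr hu')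
    · have hr' : 0 < v r := hy'.trans hr
      refine ⟨-(r * u), neg_ne_zero.2 (mul_ne_zero ((v.pos_iff).1 hr') hu), j, fun i => ?_⟩
      have : (X * P - C r * P).coeff i * y ^ i - (if i = j then -(r * u) else 0) =
          (X * P).coeff i * y ^ i - r * (P.coeff i * y ^ i - if i = j then u else 0) := by
        rw [hE]
        split_ifs <;> ring
      rw [Multiset.map_cons, Multiset.prod_cons, ← hP, sub_mul, this, v.map_neg, map_mul]
      refine v.map_sub_lt ?_ ?_
      · have h := v.map_add_le (hE' i).le (show v (if i = j + 1 then y * u else 0) ≤ v y * v u by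
          split_ifs <;> simp)
        rw [sub_add_cancel] at h
        exact h.trans_lt (mul_lt_mul_of_pos_right hr hu')
      · rw [map_mul]
        exact mul_lt_mul_of_pos_left (H i) hr'

/-- A root whose value differs from that of all other roots is approximated by a quotient of
coefficients. -/
theorem Valuation.exists_coeff_approx_root {N Γ : Type*} [Field N]
    [LinearOrderedCommGroupWithZero Γ]
    (v : Valuation N Γ) {y : N} (hy : y ≠ 0) (s : Multiset N) (hs : ∀ r ∈ s, v r ≠ v y) :
    ∃ j : ℕ, ((y ::ₘ s).map fun r => X - C r).prod.coeff (j + 1) ≠ 0 ∧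
      v (-((y ::ₘ s).map fun r => X - C r).prod.coeff j /
        ((y ::ₘ s).map fun r => X - C r).prod.coeff (j + 1) - y) < v y := by
  obtain ⟨u, hu, j, H⟩ := v.exists_dominant_coeff hy s hs
  have hu' : 0 < v u := (v.pos_iff).2 hu
  have hy' : 0 < v y := (v.pos_iff).2 hy
  set P := (s.map fun r => X - C r).prod with hP
  rw [Multiset.map_cons, Multiset.prod_cons, ← hP]
  refine ⟨j, ?_⟩
  have h0 := H j
  have h1 := H (j + 1)
  have hm : v ((X * P).coeff j * y ^ j) < v y * v u := by
    rcases j with _ | j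
    · simpa using mul_pos hy' hu'
    · have := H j
      rw [if_neg (by simp), sub_zero] at this
      rw [coeff_X_mul, pow_succ', mul_left_comm, map_mul]
      exact mul_lt_mul_of_pos_left this hy'
  rw [if_pos rfl] at h0
  rw [if_neg (by simp), sub_zero] at h1
  have hq : v (((X - C y) * P).coeff (j + 1) * y ^ j) = v u := by
    have : ((X - C y) * P).coeff (j + 1) * y ^ j = u + ((P.coeff j * y ^ j - u) -
        (P.coeff (j + 1) * y ^ (j + 1))) := by
      rw [sub_mul, coeff_sub, coeff_C_mul, coeff_X_mul]; ring
    rw [this]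
    exact v.map_add_eq_of_lt_left (v.map_sub_lt h0 h1)
  have hq0 : ((X - C y) * P).coeff (j + 1) ≠ 0 := by
    intro h
    rw [h, zero_mul, map_zero] at hq
    exact hu'.ne hq
  refine ⟨hq0, ?_⟩
  have hyj : y ^ j ≠ 0 := pow_ne_zero _ hy
  have key : -((X - C y) * P).coeff j / ((X - C y) * P).coeff (j + 1) - y =
      -((X * P).coeff j * y ^ j - y * (P.coeff (j + 1) * y ^ (j + 1))) /
        (((X - C y) * P).coeff (j + 1) * y ^ j) := by
    rw [div_sub' hq0, div_eq_div_iff hq0 (mul_ne_zero hq0 hyj)]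
    have e1 : ((X - C y) * P).coeff (j + 1) = P.coeff j - y * P.coeff (j + 1) := by
      rw [sub_mul, coeff_sub, coeff_C_mul, coeff_X_mul]
    have e2 : ((X - C y) * P).coeff j = (X * P).coeff j - y * P.coeff j := by
      rw [sub_mul, coeff_sub, coeff_C_mul]
    rw [e1, e2]; ring
  rw [key, map_div₀, hq, v.map_neg, div_lt_iff₀ hu']
  refine v.map_sub_lt hm ?_
  rw [map_mul]
  exact mul_lt_mul_of_pos_left h1 hy'

/-- The decomposition group of `v` over `K`: automorphisms preserving the valuation ring. -/
def Valuation.decompositionGroup (K : Type*) {N Γ : Type*} [Field K] [Field N] [Algebra K N]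
    [LinearOrderedCommGroupWithZero Γ] (v : Valuation N Γ) : Subgroup (N ≃ₐ[K] N) where
  carrier := {g | ∀ x, v (g x) ≤ 1 ↔ v x ≤ 1}
  mul_mem' {g h} hg hh x := (hg (h x)).trans (hh x)
  one_mem' _ := Iff.rfl
  inv_mem' {g} hg x := by simpa using (hg (g⁻¹ x)).symm

namespace Valuation

section Decomposition

variable {K N Γ : Type*} [Field K] [Field N] [Algebra K N] [LinearOrderedCommGroupWithZero Γ]
  (v : Valuation N Γ)

theorem mem_decompositionGroup {g : N ≃ₐ[K] N} :
    g ∈ v.decompositionGroup K ↔ ∀ x, v (g x) ≤ 1 ↔ v x ≤ 1 := Iff.rfl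

theorem map_eq_one_iff_of_mem_decompositionGroup {g : N ≃ₐ[K] N}
    (hg : g ∈ v.decompositionGroup K) (x : N) : v (g x) = 1 ↔ v x = 1 := by
  rcases eq_or_ne x 0 with rfl | hx
  · simp
  have key (z : N) (hz : z ≠ 0) : v z = 1 ↔ v z ≤ 1 ∧ v z⁻¹ ≤ 1 := by
    rw [map_inv₀, inv_le_one₀ ((v.pos_iff).2 hz), le_antisymm_iff]
  rw [key _ hx, key _ ((map_ne_zero g).2 hx), ← map_inv₀ g, hg x, hg x⁻¹]

theorem mem_decompositionGroup_of_le [FiniteDimensional K N] {g : N ≃ₐ[K] N}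
    (h : ∀ x, v x ≤ 1 → v (g x) ≤ 1) : g ∈ v.decompositionGroup K := by
  have hpow (n : ℕ) : ∀ x, v x ≤ 1 → v ((g ^ n) x) ≤ 1 := by
    induction n with
    | zero => simp
    | succ n ih => exact fun x hx => by rw [pow_succ']; exact h _ (ih x hx)
  refine fun x => ⟨fun hx => ?_, h x⟩
  have hinv : (g ^ (orderOf g - 1)) (g x) = x := by
    rw [← AlgEquiv.mul_apply, ← pow_succ, Nat.sub_add_cancel (orderOf_pos g), pow_orderOf_eq_one,
      AlgEquiv.one_apply]
  simpa [hinv] using hpow (orderOf g - 1) _ hx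

/-- An algebraic element `x` of the valuation ring is a fraction with denominator a unit `u`, such
that `u` and `u * x` are in every valuation ring containing the valuation ring of `K`. -/
theorem exists_unit_denominator {x : N} (hx : IsAlgebraic K x) (hvx : v x ≤ 1) :
    ∃ u : N, v u = 1 ∧ ∀ w : Valuation N Γ,
      (∀ c : K, v (algebraMap K N c) ≤ 1 → w (algebraMap K N c) ≤ 1) →
        w u ≤ 1 ∧ w (u * x) ≤ 1 := by
  obtain ⟨P, hP0, hPx⟩ := hx
  obtain ⟨j₀, hj₀, hmax₀⟩ := P.support.exists_max_image
    (fun i => v (algebraMap K N (P.coeff i))) (nonempty_support_iff.2 hP0)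
  obtain ⟨j, hjS, hj⟩ := (P.support.filter
    fun i => v (algebraMap K N (P.coeff j₀)) ≤ v (algebraMap K N (P.coeff i))).exists_max_image id
      ⟨j₀, by simp [mem_support_iff.1 hj₀]⟩
  rw [Finset.mem_filter] at hjS
  have hc0 : P.coeff j ≠ 0 := mem_support_iff.1 hjS.1
  have hv0 : 0 < v (algebraMap K N (P.coeff j)) := by simpa [zero_lt_iff] using hc0
  set q : ℕ → N := fun i => algebraMap K N (P.coeff i / P.coeff j) with hq
  have hqle (i : ℕ) : v (q i) ≤ 1 := by
    by_cases hi : i ∈ P.support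
    · simp only [hq, map_div₀]
      exact (div_le_one₀ hv0).2 ((hmax₀ i hi).trans hjS.2)
    · simp [hq, notMem_support_iff.1 hi]
  have hqlt (i : ℕ) (hij : j < i) : v (q i) < 1 := by
    by_cases hi : i ∈ P.support
    · simp only [hq, map_div₀]
      refine (div_lt_one₀ hv0).2 (lt_of_lt_of_le ?_ hjS.2)
      by_contra hcon
      exact (hj i (Finset.mem_filter.2 ⟨hi, not_lt.1 hcon⟩)).not_gt hij
    · simp [hq, notMem_support_iff.1 hi]
  have hqj : q j = 1 := by rw [hq]; simp [hc0]
  set n := P.natDegree + 1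
  have hjn : j < n := Nat.lt_succ_of_le (le_natDegree_of_ne_zero hc0)
  have hsum : ∑ i ∈ Finset.range n, q i * x ^ i = 0 := by
    rw [aeval_eq_sum_range] at hPx
    have : ∑ i ∈ Finset.range n, q i * x ^ i = (algebraMap K N (P.coeff j))⁻¹ *
        ∑ i ∈ Finset.range n, P.coeff i • x ^ i := by
      rw [Finset.mul_sum]
      refine Finset.sum_congr rfl fun i _ => ?_
      rw [Algebra.smul_def]
      simp only [hq, map_div₀]
      ring
    rw [this, hPx, mul_zero]
  have hsplit : ∑ i ∈ Finset.range n, q i * x ^ i = ∑ i ∈ Finset.range j, q i * x ^ i +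
      ∑ i ∈ Finset.range (n - j), q (j + i) * x ^ (j + i) := by
    rw [← Finset.sum_range_add, Nat.add_sub_cancel' hjn.le]
  set u := ∑ i ∈ Finset.range (n - j), q (j + i) * x ^ i with hu
  refine ⟨u, ?_, fun w hw => ?_⟩
  · obtain ⟨k, hk⟩ : ∃ k, n - j = k + 1 := ⟨n - j - 1, by omega⟩
    rw [hu, hk, Finset.sum_range_succ']
    have : v (∑ i ∈ Finset.range k, q (j + (i + 1)) * x ^ (i + 1)) < 1 := by
      refine v.map_sum_lt one_ne_zero fun i _ => ?_
      rw [map_mul, map_pow]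
      exact mul_lt_one_of_lt_of_le (hqlt _ (by omega)) (pow_le_one₀ zero_le hvx)
    have h1 : v (q (j + 0) * x ^ 0) = 1 := by simp [hqj]
    rw [v.map_add_eq_of_lt_right (this.trans_eq h1.symm), h1]
  · have hqw (i : ℕ) : w (q i) ≤ 1 := hw _ (hqle i)
    rcases le_or_gt (w x) 1 with h | h
    · have : w u ≤ 1 := w.map_sum_le fun i _ => by
        rw [map_mul, map_pow]
        exact mul_le_one₀ (hqw _) zero_le (pow_le_one₀ zero_le h)
      exact ⟨this, by rw [map_mul]; exact mul_le_one₀ this zero_le h⟩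
    · have hx0 : x ≠ 0 := by rintro rfl; simp at h
      have hux : u * x = -∑ i ∈ Finset.range j, q i * (x⁻¹) ^ (j - 1 - i) := by
        have h1 : u * x ^ j = -∑ i ∈ Finset.range j, q i * x ^ i := by
          rw [eq_neg_iff_add_eq_zero, add_comm, ← hsum, hsplit, hu, Finset.sum_mul]
          congr 1
          exact Finset.sum_congr rfl fun i _ => by ring
        rcases Nat.eq_zero_or_pos j with h0 | hjpos
        · rw [h0, Finset.sum_range_zero, neg_zero, pow_zero, mul_one] at h1
          rw [h0, Finset.sum_range_zero, h1]; simp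
        · have hxj : x ^ (j - 1) ≠ 0 := pow_ne_zero _ hx0
          apply mul_right_cancel₀ hxj
          rw [mul_assoc, ← pow_succ', Nat.sub_add_cancel hjpos, h1, neg_mul, Finset.sum_mul]
          congr 1
          refine Finset.sum_congr rfl fun i hi => ?_
          have : i ≤ j - 1 := Nat.le_sub_one_of_lt (Finset.mem_range.1 hi)
          obtain ⟨k, hk⟩ := Nat.exists_eq_add_of_le this
          rw [hk, Nat.add_sub_cancel_left, inv_pow, pow_add, mul_assoc, mul_comm (x ^ i),
            inv_mul_cancel_left₀ (pow_ne_zero k hx0)]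
      have hxi : w x⁻¹ ≤ 1 := by rw [map_inv₀]; exact inv_le_one_of_one_le₀ h.le
      have hle : w (u * x) ≤ 1 := by
        rw [hux, w.map_neg]
        refine w.map_sum_le fun i _ => ?_
        rw [map_mul, map_pow]
        exact mul_le_one₀ (hqw _) zero_le (pow_le_one₀ zero_le hxi)
      refine ⟨?_, hle⟩
      have : u = (u * x) * x⁻¹ := by rw [mul_inv_cancel_right₀ hx0]
      rw [this, map_mul]
      exact mul_le_one₀ hle zero_le hxi

/-- An automorphism outside the decomposition group moves some unit, all of whose conjugates are in
the valuation ring, into the maximal ideal. -/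
theorem exists_unit_lt_one_of_notMem_decompositionGroup [FiniteDimensional K N] {g : N ≃ₐ[K] N}
    (hg : g ∉ v.decompositionGroup K) :
    ∃ c : N, v c = 1 ∧ (∀ h : N ≃ₐ[K] N, v (h c) ≤ 1) ∧ v (g c) < 1 := by
  by_contra! hcon
  refine hg (v.mem_decompositionGroup_of_le fun x hx => ?_)
  obtain ⟨u, hu, H⟩ := v.exists_unit_denominator (Algebra.IsAlgebraic.isAlgebraic (R := K) x) hx
  have H' (h : N ≃ₐ[K] N) : v (h u) ≤ 1 ∧ v (h (u * x)) ≤ 1 :=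
    H (v.comap (h : N →+* N)) fun c hc => by simpa using hc
  have h1 := hcon u hu fun h => (H' h).1
  have h2 := (H' g).2
  rw [map_mul, map_mul, le_antisymm (H' g).1 h1, one_mul] at h2
  exact h2

theorem exists_separating [FiniteDimensional K N] :
    ∃ b : N, v b = 1 ∧ (∀ h ∈ v.decompositionGroup K, h b = b) ∧ b ∈ separableClosure K N ∧
      ∀ g ∉ v.decompositionGroup K, v (g b) < 1 := by
  classical
  let D := v.decompositionGroup K
  choose c hc1 hc hcg using fun g : {g : N ≃ₐ[K] N // g ∉ D} =>
    v.exists_unit_lt_one_of_notMem_decompositionGroup g.2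
  let c' := ∏ g, c g
  have hc'1 : v c' = 1 := by simp [c', map_prod, hc1]
  have hc'g (g : N ≃ₐ[K] N) (hg : g ∉ D) : v (g c') < 1 := by
    simp only [c', map_prod]
    rw [← Finset.mul_prod_erase _ _ (Finset.mem_univ ⟨g, hg⟩)]
    exact mul_lt_one_of_lt_of_le (hcg ⟨g, hg⟩) (Finset.prod_le_one' fun i _ => hc i g)
  let b := ∏ h : D, (h : N ≃ₐ[K] N) c'
  have hb1 : v b = 1 := by
    simp only [b, map_prod]
    exact Finset.prod_eq_one fun h _ =>
      (v.map_eq_one_iff_of_mem_decompositionGroup h.2 c').2 hc'1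
  have hbD (h : N ≃ₐ[K] N) (hh : h ∈ D) : h b = b := by
    simp only [b, map_prod]
    exact Fintype.prod_equiv (Equiv.mulLeft (⟨h, hh⟩ : D)) _ _ fun _ => rfl
  have hbg (g : N ≃ₐ[K] N) (hg : g ∉ D) : v (g b) < 1 := by
    simp only [b, map_prod]
    rw [← Finset.mul_prod_erase _ _ (Finset.mem_univ (1 : D))]
    refine mul_lt_one_of_lt_of_le (hc'g g hg) (Finset.prod_le_one' fun h _ => ?_)
    exact (hc'g (g * h) fun hgh => hg ((Subgroup.mul_mem_cancel_right D h.2).1 hgh)).le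
  obtain ⟨n, z, hz⟩ := IsPurelyInseparable.pow_mem (separableClosure K N) (ringExpChar K) b
  have hz' : b ^ ringExpChar K ^ n ∈ separableClosure K N := hz ▸ z.2
  refine ⟨b ^ ringExpChar K ^ n, by simp [hb1], fun h hh => by rw [map_pow, hbD h hh], hz',
    fun g hg => ?_⟩
  rw [map_pow, map_pow]
  exact pow_lt_one₀ zero_le (hbg g hg) (pow_ne_zero _ (expChar_pos K _).ne')

theorem exists_approx_of_separated [Normal K N] {y : N} (hy : y ≠ 0) (hsep : IsSeparable K y)
    (hne : ∀ g : N ≃ₐ[K] N, g y ≠ y → v (g y) ≠ v y) :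
    ∃ c : K, v (algebraMap K N c - y) < v y := by
  classical
  have hint := Normal.isIntegral ‹Normal K N› y
  set P := minpoly K y
  set s := (P.map (algebraMap K N)).roots.erase y
  have hmonic : (P.map (algebraMap K N)).Monic := (minpoly.monic hint).map _
  have hroot : y ∈ (P.map (algebraMap K N)).roots := by
    rw [mem_roots hmonic.ne_zero, IsRoot.def, eval_map_algebraMap, minpoly.aeval]
  have hnodup : (P.map (algebraMap K N)).roots.Nodup :=
    nodup_roots (Polynomial.Separable.map (f := algebraMap K N) hsep)
  have hs : ∀ r ∈ s, v r ≠ v y := by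
    intro r hr
    rw [hnodup.mem_erase_iff, mem_roots hmonic.ne_zero, IsRoot.def, eval_map_algebraMap] at hr
    obtain ⟨hry, hr⟩ := hr
    have : minpoly K y = minpoly K r :=
      minpoly.eq_of_irreducible_of_monic (minpoly.irreducible hint) hr (minpoly.monic hint)
    obtain ⟨g, rfl⟩ := (Normal.minpoly_eq_iff_mem_orbit N).1 this.symm
    exact hne g hry
  have hprod : ((y ::ₘ s).map fun r => X - C r).prod = P.map (algebraMap K N) := by
    rw [Multiset.cons_erase hroot]
    exact ((Normal.splits ‹Normal K N› y).eq_prod_roots_of_monic hmonic).symm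
  obtain ⟨j, -, hj⟩ := v.exists_coeff_approx_root hy s hs
  rw [hprod, coeff_map, coeff_map] at hj
  exact ⟨-P.coeff j / P.coeff (j + 1), by rw [map_div₀, _root_.map_neg]; exact hj⟩

theorem exists_approx [Normal K N] [FiniteDimensional K N] {a : N} (ha : a ≠ 0)
    (hD : ∀ h ∈ v.decompositionGroup K, h a = a) (hsep : a ∈ separableClosure K N) :
    ∃ c : K, v (algebraMap K N c - a) < v a := by
  obtain ⟨b, hb1, hbD, hbsep, hbg⟩ := v.exists_separating (K := K)
  have hb0 : b ≠ 0 := by rintro rfl; simp at hb1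
  have hfin : {k : ℕ | ∃ g : N ≃ₐ[K] N, g ∉ v.decompositionGroup K ∧
      v (g (a * b ^ k)) = v a}.Finite := by
    have : {k : ℕ | ∃ g : N ≃ₐ[K] N, g ∉ v.decompositionGroup K ∧ v (g (a * b ^ k)) = v a} =
        ⋃ g : N ≃ₐ[K] N, {k | g ∉ v.decompositionGroup K ∧ v (g (a * b ^ k)) = v a} := by
      ext; simp
    rw [this]
    refine Set.finite_iUnion fun g => Set.Subsingleton.finite ?_
    rintro k ⟨hg, hk⟩ l ⟨-, hl⟩
    have h0 : v (g a) ≠ 0 := by simpa using ha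
    have := hk.trans hl.symm
    simp only [map_mul, map_pow] at this
    have := mul_left_cancel₀ h0 this
    exact (pow_right_strictAnti₀ (by simpa [zero_lt_iff] using hb0) (hbg g hg)).injective this
  obtain ⟨k, hk⟩ := (hfin.union (Set.finite_singleton 0)).infinite_compl.nonempty
  simp only [Set.mem_compl_iff, Set.mem_union, not_or, Set.mem_ofPred_eq, Set.mem_singleton_iff,
    not_exists, not_and] at hk
  obtain ⟨hk, hk0⟩ := hk
  have hvb : v (b ^ k) = 1 := by simp [hb1]
  have hbk : b ^ k ≠ 0 := pow_ne_zero _ hb0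
  obtain ⟨c, hc⟩ := v.exists_approx_of_separated (K := K) (mul_ne_zero ha hbk)
    (mem_separableClosure_iff.1 (mul_mem hsep (pow_mem hbsep k))) fun g hg => by
      rw [map_mul v a, hvb, mul_one]
      refine hk g fun hgD => hg ?_
      rw [map_mul, map_pow, hD g hgD, hbD g hgD]
  obtain ⟨d, hd⟩ := v.exists_approx_of_separated (K := K) hbk
    (mem_separableClosure_iff.1 (pow_mem hbsep k)) fun g hg => by
      rw [hvb, map_pow, map_pow]
      refine (pow_lt_one₀ zero_le (hbg g fun hgD => hg ?_) hk0).ne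
      rw [map_pow, hbD g hgD]
  rw [map_mul, hvb, mul_one] at hc
  rw [hvb] at hd
  have hvd : v (algebraMap K N d) = 1 := by
    exact (v.map_eq_of_sub_lt (hd.trans_eq hvb.symm)).trans hvb
  have hd0 : algebraMap K N d ≠ 0 := by intro h; simp [h] at hvd
  refine ⟨c / d, ?_⟩
  have : algebraMap K N (c / d) - a =
      ((algebraMap K N c - a * b ^ k) - a * (algebraMap K N d - b ^ k)) / algebraMap K N d := by
    rw [map_div₀, div_sub' hd0]; ring
  rw [this, map_div₀, hvd, div_one]
  refine v.map_sub_lt hc ?_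
  rw [map_mul]
  exact mul_lt_of_lt_one_right ((v.pos_iff).2 ha) hd

theorem isIntegral_of_fixed [FiniteDimensional K N] (R : Type*) [CommRing R] [Algebra R N]
    (hR : ∀ z : N, v z ≤ 1 → (∀ h ∈ v.decompositionGroup K, h z = z) → z ∈ separableClosure K N →
      z ∈ (algebraMap R N).range) {a : N} (ha : v a ≤ 1) : IsIntegral R a := by
  classical
  have fixed (z : N) (hz : v z ≤ 1) (hzD : ∀ h ∈ v.decompositionGroup K, h z = z) :
      IsIntegral R z := by
    obtain ⟨n, s, hs⟩ := IsPurelyInseparable.pow_mem (separableClosure K N) (ringExpChar K) z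
    have hs' : z ^ ringExpChar K ^ n ∈ separableClosure K N := hs ▸ s.2
    obtain ⟨r, hr⟩ := hR (z ^ ringExpChar K ^ n) (by rw [map_pow]; exact pow_le_one₀ zero_le hz)
      (fun h hh => by rw [map_pow, hzD h hh]) hs'
    refine IsIntegral.of_pow (pow_pos (expChar_pos K _) n) (hr ▸ isIntegral_algebraMap)
  let D := v.decompositionGroup K
  let P : N[X] := ∏ h : D, (X - C ((h : N ≃ₐ[K] N) a))
  have hPmonic : P.Monic := monic_prod_of_monic _ _ fun h _ => monic_X_sub_C _
  have hPfix (h : N ≃ₐ[K] N) (hh : h ∈ D) : P.map (h : N →+* N) = P := by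
    simp only [P, Polynomial.map_prod, Polynomial.map_sub, map_X, map_C]
    exact Fintype.prod_equiv (Equiv.mulLeft (⟨h, hh⟩ : D)) _ _ fun _ => rfl
  have hPint (i : ℕ) : v (P.coeff i) ≤ 1 := by
    let Q : v.integer[X] := ∏ h : D, (X - C ⟨(h : N ≃ₐ[K] N) a, (h.2 a).2 ha⟩)
    have hQ : P = Q.map v.integer.subtype := by
      simp only [P, Q, Polynomial.map_prod, Polynomial.map_sub, map_X, map_C]
      rfl
    rw [hQ, coeff_map]
    exact (Q.coeff i).2
  have hcoeff (i : ℕ) : IsIntegral R (P.coeff i) := by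
    refine fixed _ (hPint i) fun h hh => ?_
    conv_rhs => rw [← hPfix h hh]
    rw [coeff_map]; rfl
  have hroot : P.eval a = 0 := by
    rw [eval_prod]
    exact Finset.prod_eq_zero (Finset.mem_univ (1 : D)) (by simp)
  let I := integralClosure R N
  have hlift : P ∈ Polynomial.lifts (algebraMap I N) := by
    rw [lifts_iff_coeff_lifts]
    exact fun i => ⟨⟨_, hcoeff i⟩, rfl⟩
  obtain ⟨Q, hQ, -, hQm⟩ := lifts_and_degree_eq_and_monic hlift hPmonic
  have : IsIntegral I a := ⟨Q, hQm, by rw [← eval_map, hQ, hroot]⟩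
  exact isIntegral_trans a this

end Decomposition

end Valuation

/-- A nonzero element of a finite torsion-free module over a valuation ring is a multiple of an
element which does not vanish modulo the maximal ideal. -/
theorem ValuationRing.exists_eq_smul_notMem {R T : Type*} [CommRing R] [IsDomain R]
    [ValuationRing R] [AddCommGroup T] [Module R T] [Module.Finite R T]
    [Module.IsTorsionFree R T] {x : T} (hx : x ≠ 0) :
    ∃ (c : R) (b : T), x = c • b ∧ b ∉ IsLocalRing.maximalIdeal R • (⊤ : Submodule R T) := by
  have : Module.Flat R T := Module.Flat.flat_iff_torsion_eq_bot_of_isBezout.2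
    (Submodule.isTorsionFree_iff_torsion_eq_bot.1 inferInstance)
  have : Module.Free R T := Module.free_of_flat_of_isLocalRing
  let e := Module.Free.chooseBasis R T
  let ι := Module.Free.ChooseBasisIndex R T
  have : Nonempty ι := by
    by_contra h
    rw [not_nonempty_iff] at h
    exact hx (e.ext_elem fun i => (h.false i).elim)
  obtain ⟨i, hi⟩ : ∃ i, ∀ j, e.repr x i ∣ e.repr x j := by
    have : IsTrans R fun a b => b ∣ a := ⟨fun _ _ _ h h' => h'.trans h⟩
    refine Directed.finite_le (r := fun a b : R => b ∣ a) (f := fun k : ι => e.repr x k)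
      (fun i j => ?_) id
    rcases ValuationRing.dvd_total (e.repr x i) (e.repr x j) with h | h
    · exact ⟨i, dvd_rfl, h⟩
    · exact ⟨j, h, dvd_rfl⟩
  choose d hd using hi
  have hxi : e.repr x i ≠ 0 := fun h => hx (e.ext_elem fun j => by simp [hd j, h])
  refine ⟨e.repr x i, ∑ j, d j • e j, ?_, fun hmem => ?_⟩
  · rw [Finset.smul_sum]
    conv_lhs => rw [← e.sum_repr x]
    exact Finset.sum_congr rfl fun j _ => by rw [smul_smul, ← hd j]
  · have hdi : d i = 1 := mul_left_cancel₀ hxi (by rw [← hd i, mul_one])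
    have h1 : (e.coord i) (∑ j, d j • e j) = 1 := by
      simp [Finsupp.single_apply, hdi]
    have h2 : e.coord i (∑ j, d j • e j) ∈ IsLocalRing.maximalIdeal R := by
      refine Submodule.smul_induction_on hmem (fun r hr t _ => ?_) fun a b ha hb => ?_
      · rw [map_smul, smul_eq_mul]
        exact Ideal.mul_mem_right _ _ hr
      · rw [map_add]
        exact add_mem ha hb
    rw [h1] at h2
    exact (Ideal.ne_top_iff_one _).1 (IsLocalRing.maximalIdeal.isMaximal R).ne_top h2

namespace Valuation

section Decomposition

variable {K N Γ : Type*} [Field K] [Field N] [Algebra K N] [LinearOrderedCommGroupWithZero Γ]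
  (v : Valuation N Γ)

/-- The valuation ring of the restriction of `v` to the separable part of the decomposition field
over `K`. -/
def decompositionSubring (K : Type*) [Field K] [Algebra K N] (v : Valuation N Γ) : Subring N :=
  v.integer ⊓ (IntermediateField.fixedField (v.decompositionGroup K) ⊓
    separableClosure K N : IntermediateField K N).toSubfield.toSubring

theorem mem_decompositionSubring {z : N} : z ∈ v.decompositionSubring K ↔
    v z ≤ 1 ∧ (∀ h ∈ v.decompositionGroup K, h z = z) ∧ z ∈ separableClosure K N := by
  simp only [decompositionSubring, Subring.mem_inf]
  refine and_congr Iff.rfl ?_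
  change z ∈ IntermediateField.fixedField (v.decompositionGroup K) ∧ _ ↔ _
  refine and_congr ?_ Iff.rfl
  rw [IntermediateField.mem_fixedField_iff]

theorem algebraMap_mem_decompositionSubring {c : K} (hc : v (algebraMap K N c) ≤ 1) :
    algebraMap K N c ∈ v.decompositionSubring K :=
  v.mem_decompositionSubring.2 ⟨hc, fun h _ => h.commutes c, IntermediateField.algebraMap_mem _ c⟩

theorem div_mem_decompositionSubring {a b : N} (ha : a ∈ v.decompositionSubring K)
    (hb : b ∈ v.decompositionSubring K) (hab : v (a / b) ≤ 1) :
    a / b ∈ v.decompositionSubring K := by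
  rw [mem_decompositionSubring] at *
  exact ⟨hab, fun h hh => by rw [map_div₀, ha.2.1 h hh, hb.2.1 h hh], div_mem ha.2.2 hb.2.2⟩

instance : ValuationRing (v.decompositionSubring K) where
  cond' a b := by
    have key (a b : v.decompositionSubring K) (h : v a ≤ v b) : ∃ c, b * c = a := by
      rcases eq_or_ne (b : N) 0 with hb | hb
      · have ha : (a : N) = 0 := by simpa [hb] using h
        exact ⟨0, Subtype.ext (by simp [ha])⟩
      · refine ⟨⟨a / b, v.div_mem_decompositionSubring a.2 b.2 ?_⟩,
          Subtype.ext (mul_div_cancel₀ _ hb)⟩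
        rw [map_div₀]
        exact (div_le_one₀ ((v.pos_iff).2 hb)).2 h
    rcases le_total (v a) (v b) with h | h
    · obtain ⟨c, hc⟩ := key a b h
      exact ⟨c, .inr hc⟩
    · obtain ⟨c, hc⟩ := key b a h
      exact ⟨c, .inl hc⟩

theorem mem_maximalIdeal_decompositionSubring_iff {r : v.decompositionSubring K} :
    r ∈ IsLocalRing.maximalIdeal (v.decompositionSubring K) ↔ v r < 1 := by
  have hr := (v.mem_decompositionSubring.1 r.2).1
  rw [IsLocalRing.mem_maximalIdeal, mem_nonunits_iff, not_iff_comm, not_lt]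
  constructor
  · intro h
    have h1 : v (r : N) = 1 := le_antisymm hr h
    have h0 : (r : N) ≠ 0 := by intro h; simp [h] at h1
    refine IsUnit.of_mul_eq_one ⟨1 / r, v.div_mem_decompositionSubring (one_mem _) r.2
      (by simp [h1])⟩ (Subtype.ext (mul_one_div_cancel h0))
  · intro h
    obtain ⟨s, hs⟩ := h.exists_right_inv
    have h1 : v (r : N) * v (s : N) = 1 := by
      rw [← map_mul, ← Subring.coe_mul, hs, Subring.coe_one, map_one]
    by_contra hlt
    exact (mul_lt_one_of_lt_of_le (not_le.1 hlt) (v.mem_decompositionSubring.1 s.2).1).ne h1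

theorem isIntegral_decompositionSubring [FiniteDimensional K N] {a : N} (ha : v a ≤ 1) :
    IsIntegral (v.decompositionSubring K) a :=
  v.isIntegral_of_fixed (K := K) _
    (fun z h1 h2 h3 => ⟨⟨z, v.mem_decompositionSubring.2 ⟨h1, h2, h3⟩⟩, rfl⟩) ha

theorem exists_approx_decompositionSubring [Normal K N] [FiniteDimensional K N]
    {a : v.decompositionSubring K} (ha : a ≠ 0) : ∃ c : K, v (algebraMap K N c - a) < v a :=
  have h := v.mem_decompositionSubring.1 a.2
  v.exists_approx (by simpa using ha) h.2.1 h.2.2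

theorem exists_map_eq_decompositionSubring [Normal K N] [FiniteDimensional K N]
    (a : v.decompositionSubring K) : ∃ c : K, v (algebraMap K N c) = v a := by
  rcases eq_or_ne a 0 with rfl | ha
  · exact ⟨0, by simp⟩
  · obtain ⟨c, hc⟩ := v.exists_approx_decompositionSubring ha
    exact ⟨c, v.map_eq_of_sub_lt hc⟩

end Decomposition

end Valuation

namespace Valuation

section EssentiallyOfFiniteType

variable {K L N Γ Γ₀ : Type*} [Field K] [Field L] [Field N] [Algebra K L]
  [Algebra K N] [Algebra L N] [IsScalarTower K L N]
  [LinearOrderedCommGroupWithZero Γ] [LinearOrderedCommGroupWithZero Γ₀]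

/-- If a finite algebra over the decomposition ring contains the valuation ring of `ω` and is
generated by it modulo the maximal ideal, then every value of `ω` is, up to a value attained on
`K`, the value of an element which is larger than all values `< 1` attained on `K`. -/
theorem exists_coset_representative [Normal K N] [FiniteDimensional K N] {ω : Valuation L Γ₀}
    {v : Valuation N Γ} (hv : ω.IsEquiv (v.comap (algebraMap L N)))
    (T : Subalgebra (v.decompositionSubring K) N) (hTfg : (Subalgebra.toSubmodule T).FG)
    (hTv : ∀ t ∈ T, v t ≤ 1) (hωT : ∀ z : L, ω z ≤ 1 → algebraMap L N z ∈ T)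
    (hT : ∀ t : T, ∃ z : L, ω z ≤ 1 ∧ ∃ m ∈ IsLocalRing.maximalIdeal (v.decompositionSubring K) •
      (⊤ : Submodule (v.decompositionSubring K) T), (t : N) = algebraMap L N z + m)
    {x : L} (hx0 : x ≠ 0) (hx : ω x ≤ 1) :
    ∃ (c : K) (z : L), ω x = ω (algebraMap K L c) * ω z ∧ ω z ≤ 1 ∧
      ∀ d : K, ω (algebraMap K L d) < 1 → ω (algebraMap K L d) < ω z := by
  have : Module.Finite (v.decompositionSubring K) T := Module.Finite.iff_fg.2 hTfg
  have hx0' : (⟨algebraMap L N x, hωT x hx⟩ : T) ≠ 0 := by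
    intro h; exact hx0 (by simpa using congrArg Subtype.val h)
  obtain ⟨c, b, hcb, hb⟩ := ValuationRing.exists_eq_smul_notMem (R := v.decompositionSubring K) hx0'
  obtain ⟨z, hz, m, hm, hbz⟩ := hT b
  have hKL (d : K) : algebraMap L N (algebraMap K L d) = algebraMap K N d :=
    (IsScalarTower.algebraMap_apply K L N d).symm
  have hlt : ∀ d : K, ω (algebraMap K L d) < 1 → ω (algebraMap K L d) < ω z := by
    intro d hd
    by_contra! hle
    refine hb ?_
    have hbeq : b = ⟨algebraMap L N z, hωT z hz⟩ + m := Subtype.ext hbz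
    rw [hbeq]
    refine add_mem ?_ hm
    rcases eq_or_ne d 0 with rfl | hd0
    · have : z = 0 := by simpa using hle
      subst this
      have h0 : (⟨algebraMap L N 0, hωT 0 hz⟩ : T) = 0 := Subtype.ext (map_zero _)
      rw [h0]
      exact zero_mem _
    · have hdL : algebraMap K L d ≠ 0 := by simpa using hd0
      have hvd : v (algebraMap K N d) < 1 := by
        rw [← hKL]; exact hv.lt_one_iff_lt_one.1 hd
      have hzd : ω (z / algebraMap K L d) ≤ 1 := by
        rw [map_div₀]; exact (div_le_one₀ ((ω.pos_iff).2 hdL)).2 hle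
      have : (⟨algebraMap L N z, hωT z hz⟩ : T) =
          (⟨algebraMap K N d, v.algebraMap_mem_decompositionSubring hvd.le⟩ :
            v.decompositionSubring K) •
            ⟨algebraMap L N (z / algebraMap K L d), hωT _ hzd⟩ := by
        refine Subtype.ext ?_
        change algebraMap L N z = algebraMap K N d * algebraMap L N (z / algebraMap K L d)
        rw [← hKL, ← map_mul, mul_div_cancel₀ _ hdL]
      rw [this]
      exact Submodule.smul_mem_smul (v.mem_maximalIdeal_decompositionSubring_iff.2 hvd)
        Submodule.mem_top
  have hmlt : v (m : N) < v (algebraMap L N z) := by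
    refine Submodule.smul_induction_on (p := fun t : T => v (t : N) < v (algebraMap L N z)) hm
      (fun r hr t _ => ?_) fun s t hs ht => v.map_add_lt hs ht
    obtain ⟨d, hd⟩ := v.exists_map_eq_decompositionSubring r
    rw [v.mem_maximalIdeal_decompositionSubring_iff, ← hd, ← hKL] at hr
    have := hv.lt_iff_lt.1 (hlt d (hv.lt_one_iff_lt_one.2 hr))
    change v ((r : N) * (t : N)) < _
    rw [map_mul, ← hd, ← hKL]
    exact (mul_le_of_le_one_right zero_le (hTv t t.2)).trans_lt this
  obtain ⟨d, hd⟩ := v.exists_map_eq_decompositionSubring c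
  refine ⟨d, z, ?_, hz, hlt⟩
  rw [← map_mul]
  refine hv.eq_iff.2 ?_
  have h1 : algebraMap L N x = (c : N) * b := congrArg Subtype.val hcb
  rw [comap_apply, comap_apply, map_mul, map_mul, hKL, hd, h1, map_mul, hbz,
    v.map_add_eq_of_lt_left hmlt]

end EssentiallyOfFiniteType

end Valuation

/-- If `x` is integral over `R` and a subalgebra contains `x⁻¹`, then it contains `x`. -/
theorem Subalgebra.mem_of_isIntegral_of_inv_mem {R S : Type*} [CommRing R] [Field S] [Algebra R S]
    (A : Subalgebra R S) {x : S} (hx : IsIntegral R x) (hA : x⁻¹ ∈ A) : x ∈ A := by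
  rcases eq_or_ne x 0 with rfl | h0
  · exact zero_mem A
  obtain ⟨p, hp, hpx⟩ := hx
  rw [← Polynomial.aeval_def, hp.as_sum] at hpx
  simp only [map_add, map_pow, Polynomial.aeval_X, map_sum, map_mul, Polynomial.aeval_C] at hpx
  rcases hn : p.natDegree with _ | n
  · simp [hn] at hpx
  rw [hn] at hpx
  have key : x = -∑ i ∈ Finset.range (n + 1), algebraMap R S (p.coeff i) * x⁻¹ ^ (n - i) := by
    refine mul_right_cancel₀ (pow_ne_zero n h0) ?_
    rw [← pow_succ', eq_neg_of_add_eq_zero_left hpx, neg_mul, Finset.sum_mul]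
    refine congrArg Neg.neg (Finset.sum_congr rfl fun i hi => ?_)
    have hi' : n = n - i + i :=
      (Nat.sub_add_cancel (Nat.lt_succ_iff.1 (Finset.mem_range.1 hi))).symm
    conv_rhs => rw [mul_assoc, hi', pow_add, Nat.add_sub_cancel, ← mul_assoc (x⁻¹ ^ _), ← mul_pow,
      inv_mul_cancel₀ h0, one_pow, one_mul]
  rw [key]
  exact neg_mem (sum_mem fun i _ => mul_mem (A.algebraMap_mem _) (pow_mem hA _))

namespace Valuation

/-- If the valuation ring of `ω` is essentially of finite type over the valuation ring of its
restriction to `K`, then it is contained in a finite algebra over the decomposition ring of an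
extension of `ω` to a normal closure, and generates it modulo the maximal ideal. -/
theorem exists_finite_subalgebra {K L : Type u} {Γ₀ : Type u} {N Γ : Type*} [Field K] [Field L]
    [Field N] [Algebra K L] [Algebra K N] [Algebra L N] [IsScalarTower K L N] [Normal K N]
    [FiniteDimensional K N] [LinearOrderedCommGroupWithZero Γ] [LinearOrderedCommGroupWithZero Γ₀]
    {ω : Valuation L Γ₀} {v : Valuation N Γ} (hv : ω.IsEquiv (v.comap (algebraMap L N)))
    (hft : Algebra.EssentiallyOfFiniteType
      ↥((ω.comap (algebraMap K L)).valuationSubring) ↥(ω.valuationSubring)) :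
    ∃ T : Subalgebra (v.decompositionSubring K) N, (Subalgebra.toSubmodule T).FG ∧
      (∀ t ∈ T, v t ≤ 1) ∧ (∀ z : L, ω z ≤ 1 → algebraMap L N z ∈ T) ∧
      ∀ t : T, ∃ z : L, ω z ≤ 1 ∧ ∃ m ∈ IsLocalRing.maximalIdeal (v.decompositionSubring K) •
        (⊤ : Submodule (v.decompositionSubring K) T), (t : N) = algebraMap L N z + m := by
  obtain ⟨C, _, _, _, _, M, ⟨⟨s, hs⟩⟩, hM⟩ := hft
  let φ : C →+* N := ((algebraMap L N).comp ω.valuationSubring.subtype).comp (algebraMap C _)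
  have hvω (z : L) : v (algebraMap L N z) ≤ 1 ↔ ω z ≤ 1 := hv.le_one_iff_le_one.symm
  have hφv (c : C) : v (φ c) ≤ 1 := (hvω _).2 (algebraMap C ω.valuationSubring c).2
  have hφK (r : (ω.comap (algebraMap K L)).valuationSubring) :
      φ (algebraMap _ C r) = algebraMap K N r := by
    change algebraMap L N (algebraMap C ω.valuationSubring (algebraMap _ C r) : L) = _
    rw [← IsScalarTower.algebraMap_apply _ C ω.valuationSubring,
      IsScalarTower.algebraMap_apply K L N]
    rfl
  let T : Subalgebra (v.decompositionSubring K) N := Algebra.adjoin _ (φ '' s)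
  have hRv (r : v.decompositionSubring K) : v (r : N) ≤ 1 := (v.mem_decompositionSubring.1 r.2).1
  have hTv : ∀ t ∈ T, v t ≤ 1 := by
    intro t ht
    induction ht using Algebra.adjoin_induction with
    | mem t ht => obtain ⟨c, -, rfl⟩ := ht; exact hφv c
    | algebraMap r => exact hRv r
    | add a b _ _ ha hb => exact v.map_add_le ha hb
    | mul a b _ _ ha hb => rw [map_mul]; exact mul_le_one' ha hb
  have hφT (c : C) : φ c ∈ T := by
    have hc : c ∈ Algebra.adjoin (ω.comap (algebraMap K L)).valuationSubring (s : Set C) := by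
      rw [hs]; trivial
    induction hc using Algebra.adjoin_induction with
    | mem c hc => exact Algebra.subset_adjoin ⟨c, hc, rfl⟩
    | algebraMap r =>
      have hr : v (algebraMap K N r) ≤ 1 := hφK r ▸ hφv _
      rw [hφK]
      exact T.algebraMap_mem ⟨algebraMap K N r, v.algebraMap_mem_decompositionSubring hr⟩
    | add a b _ _ ha hb => rw [map_add]; exact add_mem ha hb
    | mul a b _ _ ha hb => rw [map_mul]; exact mul_mem ha hb
  have hωT (z : L) (hz : ω z ≤ 1) : algebraMap L N z ∈ T := by
    obtain ⟨⟨c, m⟩, hcm⟩ := IsLocalization.surj M (⟨z, hz⟩ : ω.valuationSubring)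
    obtain ⟨w, hw⟩ := (IsLocalization.map_units ω.valuationSubring m).exists_right_inv
    have hw' : φ m * algebraMap L N w = 1 := by
      have := congrArg (fun y : ω.valuationSubring => algebraMap L N y) hw
      simpa [φ] using this
    have hwinv : (algebraMap L N w)⁻¹ = φ m := (eq_inv_of_mul_eq_one_left hw').symm
    have hwT : algebraMap L N w ∈ T :=
      T.mem_of_isIntegral_of_inv_mem (v.isIntegral_decompositionSubring (K := K) ((hvω _).2 w.2))
        (hwinv ▸ hφT m)
    have hz' : algebraMap L N z * φ m = φ c := by
      have := congrArg (fun y : ω.valuationSubring => algebraMap L N y) hcm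
      simpa [φ] using this
    have : algebraMap L N z = φ c * algebraMap L N w := by
      rw [← hz', mul_assoc, hw', mul_one]
    rw [this]
    exact mul_mem (hφT c) hwT
  refine ⟨T, ?_, hTv, hωT, ?_⟩
  · refine fg_adjoin_of_finite (s.finite_toSet.image φ) ?_
    rintro _ ⟨c, -, rfl⟩
    exact v.isIntegral_decompositionSubring (K := K) (hφv c)
  let I : Submodule (v.decompositionSubring K) T :=
    IsLocalRing.maximalIdeal (v.decompositionSubring K) • ⊤
  have hImul (t m : T) (hm : m ∈ I) : t * m ∈ I := by
    refine Submodule.smul_induction_on (p := fun m => t * m ∈ I) hm (fun r hr m _ => ?_)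
      fun a b ha hb => ?_
    · rw [mul_smul_comm]
      exact Submodule.smul_mem_smul hr Submodule.mem_top
    · rw [mul_add]
      exact add_mem ha hb
  rintro ⟨t, ht⟩
  change ∃ z : L, ω z ≤ 1 ∧ ∃ m ∈ I, t = algebraMap L N z + m
  induction ht using Algebra.adjoin_induction with
  | mem t ht =>
    obtain ⟨c, -, rfl⟩ := ht
    exact ⟨algebraMap C ω.valuationSubring c, (algebraMap C ω.valuationSubring c).2, 0,
      zero_mem _, by simp [φ]⟩
  | algebraMap r =>
    rcases eq_or_ne r 0 with rfl | hr
    · exact ⟨0, by simp, 0, zero_mem _, by simp⟩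
    obtain ⟨c, hc⟩ := v.exists_approx_decompositionSubring hr
    have hvc : v (algebraMap K N c) ≤ 1 := v.map_eq_of_sub_lt hc ▸ hRv r
    have hKL : algebraMap L N (algebraMap K L c) = algebraMap K N c :=
      (IsScalarTower.algebraMap_apply K L N c).symm
    let d : v.decompositionSubring K := r - ⟨_, v.algebraMap_mem_decompositionSubring hvc⟩
    have hd : d ∈ IsLocalRing.maximalIdeal (v.decompositionSubring K) := by
      rw [v.mem_maximalIdeal_decompositionSubring_iff]
      refine lt_of_lt_of_le ?_ (hRv r)
      rw [v.map_sub_swap] at hc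
      exact hc
    refine ⟨algebraMap K L c, (hvω _).1 (hKL ▸ hvc), d • 1,
      Submodule.smul_mem_smul hd Submodule.mem_top, ?_⟩
    rw [hKL]
    change (r : N) = _ + ((r : N) - algebraMap K N c) * 1
    ring
  | add a b _ _ ha hb =>
    obtain ⟨z, hz, m, hm, rfl⟩ := ha
    obtain ⟨z', hz', m', hm', rfl⟩ := hb
    exact ⟨z + z', ω.map_add_le hz hz', m + m', add_mem hm hm', by push_cast [map_add]; ring⟩
  | mul a b _ hb' ha hb =>
    obtain ⟨z, hz, m, hm, rfl⟩ := ha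
    obtain ⟨z', hz', m', hm', rfl⟩ := hb
    refine ⟨z * z', by rw [map_mul]; exact mul_le_one' hz hz',
      ⟨_, hωT z hz⟩ * m' + (⟨_, hωT z' hz'⟩ + m') * m,
      add_mem (hImul _ _ hm') (hImul _ _ hm), ?_⟩
    push_cast [map_mul]
    ring

end Valuation

namespace Valuation

/-- The values of a valuation on an algebraic extension are bounded by values on the base field. -/
theorem exists_algebraMap_ge_of_isIntegral {K L Γ₀ : Type*} [Field K] [Field L] [Algebra K L]
    [LinearOrderedCommGroupWithZero Γ₀] (ω : Valuation L Γ₀) {x : L} (hx : IsIntegral K x) :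
    ∃ c : K, ω x ≤ ω (algebraMap K L c) := by
  by_contra! h
  have h1 : 1 < ω x := by simpa using h 1
  obtain ⟨p, hp, hpx⟩ := hx
  rw [← Polynomial.aeval_def, hp.as_sum] at hpx
  simp only [map_add, map_pow, Polynomial.aeval_X, map_sum, map_mul, Polynomial.aeval_C] at hpx
  have hne : ω x ^ p.natDegree ≠ 0 := pow_ne_zero _ (zero_lt_one.trans h1).ne'
  have hlt : ω (∑ i ∈ Finset.range p.natDegree, algebraMap K L (p.coeff i) * x ^ i) <
      ω x ^ p.natDegree := by
    refine ω.map_sum_lt hne fun i hi => ?_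
    have hpos : 0 < ω x ^ i := pow_pos (zero_lt_one.trans h1) i
    calc ω (algebraMap K L (p.coeff i) * x ^ i) = ω (algebraMap K L (p.coeff i)) * ω x ^ i := by
          rw [map_mul, map_pow]
      _ < ω x * ω x ^ i := mul_lt_mul_of_pos_right (h _) hpos
      _ = ω x ^ (i + 1) := (pow_succ' _ _).symm
      _ ≤ ω x ^ p.natDegree := pow_le_pow_right₀ h1.le (Finset.mem_range.1 hi)
  rw [← map_pow, eq_neg_of_add_eq_zero_left hpx, map_neg] at hlt
  exact lt_irrefl _ hlt

/-- A valuation extends to any extension field. -/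
theorem exists_valuation_extension {L Γ₀ : Type*} [Field L] [LinearOrderedCommGroupWithZero Γ₀]
    (ω : Valuation L Γ₀) (N : Type*) [Field N] [Algebra L N] :
    ∃ A : ValuationSubring N, ω.IsEquiv (A.valuation.comap (algebraMap L N)) := by
  obtain ⟨A, hA, hloc⟩ := IsLocalRing.exists_factor_valuationRing
    ((algebraMap L N).comp ω.valuationSubring.subtype)
  refine ⟨A, isEquiv_of_val_le_one fun x => ?_⟩
  rw [comap_apply, A.valuation_le_one_iff]
  refine ⟨fun hx => hA ⟨x, hx⟩, fun hx => ?_⟩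
  by_contra! hlt
  have hx0 : x ≠ 0 := by rintro rfl; simp at hlt
  have hinv : ω x⁻¹ ≤ 1 := by rw [map_inv₀]; exact inv_le_one_of_one_le₀ hlt.le
  have hu : IsUnit (⟨x⁻¹, hinv⟩ : ω.valuationSubring) := by
    refine hloc.map_nonunit _ (IsUnit.of_mul_eq_one ⟨algebraMap L N x, hx⟩ (Subtype.ext ?_))
    change algebraMap L N x⁻¹ * algebraMap L N x = 1
    rw [← map_mul, inv_mul_cancel₀ hx0, map_one]
  obtain ⟨y, hy⟩ := hu.exists_right_inv
  have hy' : x⁻¹ * (y : L) = 1 := congrArg Subtype.val hy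
  have hxy : (y : L) = x := by
    rw [← mul_inv_cancel_left₀ hx0 (y : L), hy', mul_one]
  exact hlt.not_ge (hxy ▸ y.2)

end Valuation

/-- Let `L/K` be a finite field extension, `ω` a valuation on `L` with value
group `Γ_ω` (in multiplicative notation: `ω : L → Γ₀` is surjective and `Γ_ω = Γ₀ˣ`), and let
`ν` be the restriction of `ω` to `K`, whose value group is the subgroup `Γν ⊆ Γ₀ˣ`.  If the
valuation ring `O_ω` is essentially of finite type over `O_ν`, then the initial index
`ε(ω|ν)` — the cardinality of `{γ ∈ Γ_ω : γ ≥ 0 and γ < δ for all δ ∈ Γν with δ > 0}`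
(written multiplicatively: `γ ≤ 1` and `δ < 1 → δ < γ`) — equals the ramification index
`[Γ_ω : Γ_ν]`. -/
theorem initial_index_eq_ramification_index_of_essentiallyOfFiniteType
    [FiniteDimensional K L]
    (ω : Valuation L Γ₀) (hsurj : Function.Surjective ω)
    (Γν : Subgroup Γ₀ˣ)
    (hΓν : ∀ γ : Γ₀ˣ, γ ∈ Γν ↔ ∃ x : K, ω (algebraMap K L x) = (γ : Γ₀))
    (hft : Algebra.EssentiallyOfFiniteType
      ↥((ω.comap (algebraMap K L)).valuationSubring) ↥(ω.valuationSubring)) :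
    Cardinal.mk {γ : Γ₀ˣ // (γ : Γ₀) ≤ 1 ∧
        ∀ δ : Γ₀ˣ, δ ∈ Γν → (δ : Γ₀) < 1 → (δ : Γ₀) < (γ : Γ₀)} =
      Cardinal.mk (Γ₀ˣ ⧸ Γν) := by
  let N := IntermediateField.normalClosure K L (AlgebraicClosure L)
  obtain ⟨A, hA⟩ := ω.exists_valuation_extension N
  obtain ⟨T, hTfg, hTv, hωT, hT⟩ := Valuation.exists_finite_subalgebra hA hft
  have hmem {c : K} {γ : Γ₀ˣ} (h : ω (algebraMap K L c) = γ) : γ ∈ Γν := (hΓν γ).2 ⟨c, h⟩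
  let f (γ : {γ : Γ₀ˣ // (γ : Γ₀) ≤ 1 ∧
      ∀ δ : Γ₀ˣ, δ ∈ Γν → (δ : Γ₀) < 1 → (δ : Γ₀) < (γ : Γ₀)}) : Γ₀ˣ ⧸ Γν := (γ : Γ₀ˣ)
  refine Cardinal.mk_congr (Equiv.ofBijective f ⟨?_, ?_⟩)
  · have key (γ γ' : Γ₀ˣ) (hγ : ∀ δ : Γ₀ˣ, δ ∈ Γν → (δ : Γ₀) < 1 → (δ : Γ₀) < (γ : Γ₀))
        (hγ' : (γ' : Γ₀) ≤ 1) (h : γ'⁻¹ * γ ∈ Γν) : γ' ≤ γ := by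
      by_contra! hlt
      have h1 : γ'⁻¹ * γ < 1 := by rwa [inv_mul_lt_one_iff]
      have h2 : γ'⁻¹ * γ < γ := Units.val_lt_val.1 (hγ _ h (Units.val_lt_val.2 h1))
      have h3 : γ' ≤ 1 := Units.val_le_val.1 hγ'
      exact h2.not_ge (le_mul_of_one_le_left' (one_le_inv'.2 h3))
    rintro ⟨γ, hγ1, hγ⟩ ⟨γ', hγ'1, hγ'⟩ h
    have h' : γ⁻¹ * γ' ∈ Γν := QuotientGroup.eq.1 h
    refine Subtype.ext (le_antisymm (key γ' γ hγ' hγ1 h') (key γ γ' hγ hγ'1 ?_))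
    simpa using inv_mem h'
  · intro q
    obtain ⟨γ, rfl⟩ := QuotientGroup.mk_surjective q
    obtain ⟨x, hx⟩ := hsurj γ
    have hx0 : x ≠ 0 := by
      rintro rfl
      exact γ.ne_zero (by rw [← hx, map_zero])
    obtain ⟨c, hc⟩ := ω.exists_algebraMap_ge_of_isIntegral (Algebra.IsIntegral.isIntegral (R := K) x)
    have hc0 : ω (algebraMap K L c) ≠ 0 := (((ω.pos_iff).2 hx0).trans_le hc).ne'
    have hcL : algebraMap K L c ≠ 0 := (ω.ne_zero_iff).1 hc0
    obtain ⟨d, z, hdz, hz1, hz⟩ := Valuation.exists_coset_representative hA T hTfg hTv hωT hT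
      (div_ne_zero hx0 hcL) (by rw [map_div₀]; exact (div_le_one₀ (zero_lt_iff.2 hc0)).2 hc)
    have hne : ω (algebraMap K L d) * ω z ≠ 0 := by
      rw [← hdz]; exact (ω.ne_zero_iff).2 (div_ne_zero hx0 hcL)
    have hz0 : ω z ≠ 0 := right_ne_zero_of_mul hne
    refine ⟨⟨Units.mk0 (ω z) hz0, hz1, fun δ hδ hδ1 => ?_⟩, QuotientGroup.eq.2 ?_⟩
    · obtain ⟨e, he⟩ := (hΓν δ).1 hδ
      rw [← he] at hδ1 ⊢
      exact hz e hδ1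
    · refine hmem (c := c * d) ?_
      rw [map_mul, map_mul, Units.val_mul, Units.val_inv_eq_inv_val, Units.val_mk0,
        eq_inv_mul_iff_mul_eq₀ hz0, mul_left_comm, mul_comm (ω z), ← hdz, ← map_mul,
        mul_div_cancel₀ _ hcL, hx]
end
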